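/- arXiv:2104.14084 — 7 statements merged into one kernel-verified Lean document; each statement's English description precedes it below -/
import Mathlib

section
/- Let k ≥ 4 be an integer and δ ∈ (0,1). There exists ε₀ > 0 (depending only on k and δ) such that the following holds for every 0 < ε ≤ ε₀ and T > 0. Let a : ℝ × [0,T] → ℝ be smooth and 2π-periodic in x₂ with max_{0≤j≤k+1} sup_{x₂,t} |∂₂^j a(x₂,t)| ≤ 4ε; for each t let p_L(·,t) : ℝ² → ℝ be smooth, 2π-periodic in each variable, with zero average over [−π,π]², satisfying −Δp_L = 2 ∂₂a ∂₁f₂; and let f : ℝ² × [0,T] → ℝ² be smooth, 2π-periodic in each spatial variable, with div f = 0, ∫_{−π}^{π} f(x₁,x₂,t) dx₁ = 0 for all x₂ and t, solving ∂_t f = (1+a)² ∂₁²f + (1+a) ∇∂₁p_L − (∂₂a ∂₂p_L) e₁. Then, setting E(t) := ∫_{[−π,π]²} ( |∂₁^k f(x,t)|² + |∂₂^k f(x,t)|² ) dx, one has E(t) ≤ e^{−2(1−δ)t} E(0) for all t ∈ [0,T]. -/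
open Real Filter MeasureTheory

section Abstract

variable {A H : Type*} [CommRing A] [Algebra ℝ A] [NormedAddCommGroup H] [InnerProductSpace ℝ H]

/-- Multiplication by `b` is bounded by `M` for the seminorm `‖Φ ·‖`. -/
def MulBound (Φ : A →ₗ[ℝ] H) (b : A) (M : ℝ) : Prop :=
  ∀ u, ‖Φ (b * u)‖ ≤ M * ‖Φ u‖

/-- Two commuting derivations `X`, `Y` that are skew-adjoint for the form `⟪Φ ·, Φ ·⟫` and
satisfy Wirtinger's inequality on their ranges. -/
structure TorusCalculus (Φ : A →ₗ[ℝ] H) (X Y : Derivation ℝ A A) : Prop where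
  comm : ∀ u, X (Y u) = Y (X u)
  skew_left : ∀ u v, inner ℝ (Φ (X u)) (Φ v) = -inner ℝ (Φ u) (Φ (X v))
  skew_right : ∀ u v, inner ℝ (Φ (Y u)) (Φ v) = -inner ℝ (Φ u) (Φ (Y v))
  wirtinger_left : ∀ u, ‖Φ (X u)‖ ≤ ‖Φ (X (X u))‖
  wirtinger_right : ∀ u, ‖Φ (Y u)‖ ≤ ‖Φ (Y (Y u))‖

variable {Φ : A →ₗ[ℝ] H} {X Y L : Derivation ℝ A A}

lemma iterate_comm_of_comm (h : ∀ u, X (L u) = L (X u)) (m : ℕ) (u : A) :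
    X (L^[m] u) = L^[m] (X u) :=
  (Function.Commute.iterate_right (f := X) (g := L) h m) u

/-- Leibniz-type bound for the iterates of a derivation applied to a product. -/
lemma norm_iterate_mul_le {M R : ℝ} (hM : 0 ≤ M) (m : ℕ) (b u : A)
    (hb : ∀ j ≤ m, MulBound Φ (L^[j] b) M) (hu : ∀ i ≤ m, ‖Φ (L^[i] u)‖ ≤ R) :
    ‖Φ (L^[m] (b * u))‖ ≤ 2 ^ m * M * R := by
  induction m generalizing b u with
  | zero =>
    have h1 := hb 0 le_rfl u
    have h2 := mul_le_mul_of_nonneg_left (hu 0 le_rfl) hM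
    simp only [Function.iterate_zero, id] at *
    linarith
  | succ m ih =>
    have e : L^[m + 1] (b * u) = L^[m] (b * L u) + L^[m] (L b * u) := by
      rw [Function.iterate_succ_apply, Derivation.leibniz, iterate_map_add, smul_eq_mul,
        smul_eq_mul, mul_comm u]
    have h1 := ih b (L u) (fun j hj => hb j (by omega)) (fun i hi => by
      simpa only [Function.iterate_succ_apply] using hu (i + 1) (by omega))
    have h2 := ih (L b) u (fun j hj => by
      simpa only [Function.iterate_succ_apply] using hb (j + 1) (by omega))
      (fun i hi => hu i (by omega))
    rw [e, map_add]
    refine (norm_add_le _ _).trans ?_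
    rw [pow_succ]
    linarith

namespace TorusCalculus

lemma inner_mixed (h : TorusCalculus Φ X Y) (q : A) :
    inner ℝ (Φ (X (X q))) (Φ (Y (Y q))) = ‖Φ (Y (X q))‖ ^ 2 := by
  rw [h.skew_left, h.comm, h.comm, ← neg_eq_iff_eq_neg.mpr (h.skew_right (X q) (Y (X q))),
    real_inner_self_eq_norm_sq, neg_neg]

/-- The second derivatives are controlled by the Laplacian. -/
lemma norm_sq_laplacian (h : TorusCalculus Φ X Y) (q : A) :
    ‖Φ (X (X q) + Y (Y q))‖ ^ 2 =
      ‖Φ (X (X q))‖ ^ 2 + 2 * ‖Φ (Y (X q))‖ ^ 2 + ‖Φ (Y (Y q))‖ ^ 2 := by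
  rw [map_add, norm_add_sq_real, h.inner_mixed]

lemma second_derivatives_le (h : TorusCalculus Φ X Y) {q : A} {W : ℝ}
    (hW : ‖Φ (X (X q) + Y (Y q))‖ ≤ W) :
    ‖Φ (X (X q))‖ ≤ W ∧ ‖Φ (Y (X q))‖ ≤ W ∧ ‖Φ (Y (Y q))‖ ≤ W := by
  have h0 : 0 ≤ W := (norm_nonneg _).trans hW
  have h1 := h.norm_sq_laplacian q
  have h2 := pow_le_pow_left₀ (norm_nonneg _) hW 2
  refine ⟨abs_le_of_sq_le_sq' ?_ h0 |>.2, abs_le_of_sq_le_sq' ?_ h0 |>.2,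
    abs_le_of_sq_le_sq' ?_ h0 |>.2⟩ <;> nlinarith [sq_nonneg ‖Φ (X (X q))‖,
      sq_nonneg ‖Φ (Y (X q))‖, sq_nonneg ‖Φ (Y (Y q))‖]

/-- Coercivity of the transport-diffusion part `(1 + a)² X²`. -/
lemma inner_diffusion_le (h : TorusCalculus Φ X Y) (hL : ∀ u, X (L u) = L (X u)) {a f : A}
    (ha : X a = 0) {κ R : ℝ} (hκ : 0 ≤ κ) (k : ℕ) (hk : 2 ^ k * κ ≤ 1)
    (hb : ∀ j ≤ k, MulBound Φ (L^[j] a) κ) (hf : ∀ i ≤ k, ‖Φ (L^[i] (X f))‖ ≤ R) :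
    inner ℝ (Φ (L^[k] f)) (Φ (L^[k] ((1 + a) ^ 2 * X (X f)))) ≤
      -‖Φ (X (L^[k] f))‖ ^ 2 + 3 * (2 ^ k * κ) * R ^ 2 := by
  have e : (1 + a) ^ 2 * X (X f) = X (X f + (a * X f + (a * X f + a * (a * X f)))) := by
    simp only [map_add, Derivation.leibniz, ha, smul_eq_mul]
    ring
  have hR : 0 ≤ R := (norm_nonneg _).trans (hf 0 (Nat.zero_le _))
  set η := (2 : ℝ) ^ k * κ with hη
  have hη0 : 0 ≤ η := by positivity
  have b1 : ∀ i ≤ k, ‖Φ (L^[i] (a * X f))‖ ≤ η * R := fun i hi => by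
    refine (norm_iterate_mul_le hκ i a (X f) (fun j hj => hb j (hj.trans hi))
      (fun j hj => hf j (hj.trans hi))).trans ?_
    rw [hη]
    have : (2 : ℝ) ^ i ≤ 2 ^ k := pow_le_pow_right₀ (by norm_num) hi
    gcongr
  have b2 : ‖Φ (L^[k] (a * (a * X f)))‖ ≤ η * (η * R) :=
    norm_iterate_mul_le hκ k a _ hb b1
  have b3 := b1 k le_rfl
  have b4 := hf k le_rfl
  rw [e, ← iterate_comm_of_comm hL, ← neg_eq_iff_eq_neg.mpr (h.skew_left _ _)]
  simp only [iterate_map_add, map_add]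
  rw [iterate_comm_of_comm hL] at *
  set v := Φ (L^[k] (X f))
  set w := Φ (L^[k] (a * X f))
  set z := Φ (L^[k] (a * (a * X f)))
  have c1 := abs_le.mp (abs_real_inner_le_norm v (w + (w + z)))
  have c2 : ‖w + (w + z)‖ ≤ 3 * η * R := by
    have := norm_add_le w (w + z)
    have := norm_add_le w z
    have : η * (η * R) ≤ 1 * (η * R) := by gcongr
    linarith
  have c3 : ‖v‖ * ‖w + (w + z)‖ ≤ R * (3 * η * R) := by gcongr
  rw [inner_add_right, real_inner_self_eq_norm_sq]
  nlinarith [c1.1]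

lemma pressure_bound (h : TorusCalculus Φ X Y) (hLX : ∀ u, X (L u) = L (X u))
    (hLY : ∀ u, Y (L u) = L (Y u)) {a f p : A} {κ R : ℝ} (hκ : 0 ≤ κ) (k : ℕ)
    (hp : -(X (X p) + Y (Y p)) = (2 : ℝ) • (Y a * X f))
    (hb : ∀ j ≤ k, MulBound Φ (L^[j] (Y a)) κ) (hf : ∀ i ≤ k, ‖Φ (L^[i] (X f))‖ ≤ R) :
    ∀ i ≤ k, ‖Φ (L^[i] (X (X p)))‖ ≤ 2 * (2 ^ k * κ) * R ∧
      ‖Φ (L^[i] (Y (X p)))‖ ≤ 2 * (2 ^ k * κ) * R ∧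
      ‖Φ (L^[i] (Y p))‖ ≤ 2 * (2 ^ k * κ) * R := by
  intro i hi
  have hR : 0 ≤ R := (norm_nonneg _).trans (hf 0 (Nat.zero_le _))
  have e : X (X (L^[i] p)) + Y (Y (L^[i] p)) = -((2 : ℝ) • L^[i] (Y a * X f)) := by
    rw [iterate_comm_of_comm hLX, iterate_comm_of_comm hLX, iterate_comm_of_comm hLY,
      iterate_comm_of_comm hLY, ← iterate_map_add, ← neg_neg (X (X p) + Y (Y p)), hp,
      iterate_map_neg, two_smul, two_smul, iterate_map_add]
  have b := norm_iterate_mul_le hκ i (Y a) (X f) (fun j hj => hb j (hj.trans hi))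
      (fun j hj => hf j (hj.trans hi))
  have hW : ‖Φ (X (X (L^[i] p)) + Y (Y (L^[i] p)))‖ ≤ 2 * (2 ^ k * κ) * R := by
    rw [e, map_neg, norm_neg, map_smul, norm_smul, Real.norm_ofNat]
    have : (2 : ℝ) ^ i ≤ 2 ^ k := pow_le_pow_right₀ (by norm_num) hi
    have : (2 : ℝ) ^ i * κ * R ≤ 2 ^ k * κ * R := by gcongr
    linarith
  obtain ⟨h1, h2, h3⟩ := h.second_derivatives_le hW
  have h4 := (h.wirtinger_right (L^[i] p)).trans h3
  simp only [iterate_comm_of_comm hLX, iterate_comm_of_comm hLY] at h1 h2 h4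
  exact ⟨h1, h2, h4⟩

/-- The contribution of one component of the field and one pure derivative `L^[k]` to the
energy identity. -/
lemma energy_component_le (h : TorusCalculus Φ X Y) (hLX : ∀ u, X (L u) = L (X u))
    (hLY : ∀ u, Y (L u) = L (Y u)) {a f₁ f₂ p : A} (ha : X a = 0)
    {κ R : ℝ} (hκ : 0 ≤ κ) (k : ℕ) (hk : 2 ^ k * κ ≤ 1)
    (hp : -(X (X p) + Y (Y p)) = (2 : ℝ) • (Y a * X f₂))
    (hb : ∀ j ≤ k, MulBound Φ (L^[j] a) κ) (hb' : ∀ j ≤ k, MulBound Φ (L^[j] (Y a)) κ)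
    (hf₁ : ∀ i ≤ k, ‖Φ (L^[i] (X f₁))‖ ≤ R) (hf₂ : ∀ i ≤ k, ‖Φ (L^[i] (X f₂))‖ ≤ R)
    (hR₁ : ‖Φ (L^[k] f₁)‖ ≤ R) (hR₂ : ‖Φ (L^[k] f₂)‖ ≤ R) :
    inner ℝ (Φ (L^[k] f₁)) (Φ (L^[k] ((1 + a) ^ 2 * X (X f₁) + (1 + a) * X (X p) - Y a * Y p))) +
      inner ℝ (Φ (L^[k] f₂)) (Φ (L^[k] ((1 + a) ^ 2 * X (X f₂) + (1 + a) * Y (X p)))) ≤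
      -‖Φ (X (L^[k] f₁))‖ ^ 2 - ‖Φ (X (L^[k] f₂))‖ ^ 2 + 18 * (2 ^ k * κ) * R ^ 2 := by
  have hR : 0 ≤ R := (norm_nonneg _).trans hR₁
  have d₁ := h.inner_diffusion_le hLX ha hκ k hk hb hf₁
  have d₂ := h.inner_diffusion_le hLX ha hκ k hk hb hf₂
  have hP := h.pressure_bound hLX hLY hκ k hp hb' hf₂
  set η := (2 : ℝ) ^ k * κ with hη
  have hη0 : 0 ≤ η := by positivity
  have q₁ := norm_iterate_mul_le hκ k a _ hb (fun i hi => (hP i hi).1)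
  have q₂ := norm_iterate_mul_le hκ k a _ hb (fun i hi => (hP i hi).2.1)
  have q₃ := norm_iterate_mul_le hκ k (Y a) _ hb' (fun i hi => (hP i hi).2.2)
  have r₁ := (hP k le_rfl).1
  have r₂ := (hP k le_rfl).2.1
  have e₁ : L^[k] ((1 + a) ^ 2 * X (X f₁) + (1 + a) * X (X p) - Y a * Y p) =
      L^[k] ((1 + a) ^ 2 * X (X f₁)) +
        (L^[k] (X (X p)) + L^[k] (a * X (X p)) - L^[k] (Y a * Y p)) := by
    rw [add_mul 1 a (X (X p)), one_mul, add_sub_assoc, iterate_map_add, iterate_map_sub,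
      iterate_map_add]
  have e₂ : L^[k] ((1 + a) ^ 2 * X (X f₂) + (1 + a) * Y (X p)) =
      L^[k] ((1 + a) ^ 2 * X (X f₂)) + (L^[k] (Y (X p)) + L^[k] (a * Y (X p))) := by
    rw [add_mul 1 a (Y (X p)), one_mul, iterate_map_add, iterate_map_add]
  have hs : η * (2 * η * R) ≤ 1 * (2 * η * R) := by gcongr
  have n₁ : ‖Φ (L^[k] (X (X p)) + L^[k] (a * X (X p)) - L^[k] (Y a * Y p))‖ ≤ 6 * η * R := by
    rw [map_sub, map_add]
    have := norm_sub_le (Φ (L^[k] (X (X p))) + Φ (L^[k] (a * X (X p)))) (Φ (L^[k] (Y a * Y p)))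
    have := norm_add_le (Φ (L^[k] (X (X p)))) (Φ (L^[k] (a * X (X p))))
    linarith
  have n₂ : ‖Φ (L^[k] (Y (X p)) + L^[k] (a * Y (X p)))‖ ≤ 6 * η * R := by
    rw [map_add]
    have := norm_add_le (Φ (L^[k] (Y (X p)))) (Φ (L^[k] (a * Y (X p))))
    have : 0 ≤ η * R := by positivity
    linarith
  rw [e₁, e₂, map_add Φ, map_add Φ (L^[k] ((1 + a) ^ 2 * X (X f₂))), inner_add_right,
    inner_add_right]
  have i₁ := (real_inner_le_norm (Φ (L^[k] f₁)) _).trans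
    (mul_le_mul hR₁ n₁ (norm_nonneg _) hR)
  have i₂ := (real_inner_le_norm (Φ (L^[k] f₂)) _).trans
    (mul_le_mul hR₂ n₂ (norm_nonneg _) hR)
  linarith

lemma norm_deriv_le_iterate (hX : ∀ u, ‖Φ (X u)‖ ≤ ‖Φ (X (X u))‖) {i k : ℕ} (hik : i ≤ k)
    (u : A) : ‖Φ (X^[i] (X u))‖ ≤ ‖Φ (X^[k] (X u))‖ := by
  induction k, hik using Nat.le_induction with
  | base => exact le_rfl
  | succ n _ ih =>
    refine ih.trans ?_
    have := hX (X^[n] u)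
    rwa [← Function.iterate_succ_apply' X, ← Function.iterate_succ_apply' X,
      Function.iterate_succ_apply, Function.iterate_succ_apply] at this

/-- Dissipation inequality for the linearized magnetic relaxation operator. -/
theorem dissipation (h : TorusCalculus Φ X Y) {a f₁ f₂ p : A} (ha : X a = 0)
    {κ δ : ℝ} (hκ : 0 ≤ κ) {k : ℕ} (hk : 1 ≤ k) (hδ : 36 * (2 ^ k * κ) ≤ δ) (hδ1 : δ ≤ 1)
    (hp : -(X (X p) + Y (Y p)) = (2 : ℝ) • (Y a * X f₂))
    (hb : ∀ j ≤ k + 1, MulBound Φ (Y^[j] a) κ)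
    (hf₁ : ‖Φ (Y^[k] f₁)‖ ≤ ‖Φ (X (Y^[k] f₁))‖) (hf₂ : ‖Φ (Y^[k] f₂)‖ ≤ ‖Φ (X (Y^[k] f₂))‖)
    {g₁ g₂ : A} (hg₁ : g₁ = (1 + a) ^ 2 * X (X f₁) + (1 + a) * X (X p) - Y a * Y p)
    (hg₂ : g₂ = (1 + a) ^ 2 * X (X f₂) + (1 + a) * Y (X p)) :
    inner ℝ (Φ (X^[k] f₁)) (Φ (X^[k] g₁)) + inner ℝ (Φ (X^[k] f₂)) (Φ (X^[k] g₂)) +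
      inner ℝ (Φ (Y^[k] f₁)) (Φ (Y^[k] g₁)) + inner ℝ (Φ (Y^[k] f₂)) (Φ (Y^[k] g₂)) ≤
    -(1 - δ) * (‖Φ (X^[k] f₁)‖ ^ 2 + ‖Φ (X^[k] f₂)‖ ^ 2 + ‖Φ (Y^[k] f₁)‖ ^ 2 +
      ‖Φ (Y^[k] f₂)‖ ^ 2) := by
  set D := ‖Φ (X (X^[k] f₁))‖ ^ 2 + ‖Φ (X (X^[k] f₂))‖ ^ 2 + ‖Φ (X (Y^[k] f₁))‖ ^ 2 +
    ‖Φ (X (Y^[k] f₂))‖ ^ 2 with hD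
  have hD0 : 0 ≤ D := by positivity
  have hXX : ∀ u : A, X (X u) = X (X u) := fun _ => rfl
  have hYX : ∀ u : A, Y (X u) = X (Y u) := fun u => (h.comm u).symm
  have le_sqrt : ∀ {x : ℝ}, x ^ 2 ≤ D → x ≤ √D := fun hx => Real.le_sqrt_of_sq_le hx
  have x₁ : ‖Φ (X (X^[k] f₁))‖ ≤ √D := le_sqrt (by
    rw [hD]
    nlinarith only [sq_nonneg ‖Φ (X (X^[k] f₂))‖, sq_nonneg ‖Φ (X (Y^[k] f₁))‖,
      sq_nonneg ‖Φ (X (Y^[k] f₂))‖])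
  have x₂ : ‖Φ (X (X^[k] f₂))‖ ≤ √D := le_sqrt (by
    rw [hD]
    nlinarith only [sq_nonneg ‖Φ (X (X^[k] f₁))‖, sq_nonneg ‖Φ (X (Y^[k] f₁))‖,
      sq_nonneg ‖Φ (X (Y^[k] f₂))‖])
  have y₁ : ‖Φ (X (Y^[k] f₁))‖ ≤ √D := le_sqrt (by
    rw [hD]
    nlinarith only [sq_nonneg ‖Φ (X (X^[k] f₁))‖, sq_nonneg ‖Φ (X (X^[k] f₂))‖,
      sq_nonneg ‖Φ (X (Y^[k] f₂))‖])
  have y₂ : ‖Φ (X (Y^[k] f₂))‖ ≤ √D := le_sqrt (by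
    rw [hD]
    nlinarith only [sq_nonneg ‖Φ (X (X^[k] f₁))‖, sq_nonneg ‖Φ (X (X^[k] f₂))‖,
      sq_nonneg ‖Φ (X (Y^[k] f₁))‖])
  have bX : ∀ f : A, ‖Φ (X (X^[k] f))‖ ≤ √D → ∀ i ≤ k, ‖Φ (X^[i] (X f))‖ ≤ √D :=
    fun f hf i hi => (norm_deriv_le_iterate h.wirtinger_left hi f).trans
      (by rwa [iterate_comm_of_comm hXX] at hf)
  have bY : ∀ f : A, ‖Φ (X (X^[k] f))‖ ≤ √D → ‖Φ (X (Y^[k] f))‖ ≤ √D →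
      ∀ i ≤ k, ‖Φ (Y^[i] (X f))‖ ≤ √D := by
    intro f hf hf' i hi
    rcases i with _ | i
    · exact bX f hf 0 (Nat.zero_le _)
    · obtain ⟨m, rfl⟩ : ∃ m, k = m + 1 := ⟨k - 1, by omega⟩
      rw [iterate_comm_of_comm h.comm, Function.iterate_succ_apply] at hf'
      rw [Function.iterate_succ_apply]
      exact (norm_deriv_le_iterate h.wirtinger_right (by omega) _).trans hf'
  have zX : ∀ f : A, ‖Φ (X^[k] f)‖ ≤ ‖Φ (X (X^[k] f))‖ := by
    intro f
    obtain ⟨m, rfl⟩ : ∃ m, k = m + 1 := ⟨k - 1, by omega⟩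
    rw [Function.iterate_succ_apply']
    exact h.wirtinger_left _
  have hb0 : ∀ M : ℝ, 0 ≤ M → MulBound Φ (0 : A) M := fun M hM u => by
    rw [zero_mul, map_zero, norm_zero]
    positivity
  have itX : ∀ c : A, X c = 0 → MulBound Φ c κ → ∀ j ≤ k, MulBound Φ (X^[j] c) κ := by
    intro c hc hcb j _
    rcases j with _ | j
    · exact hcb
    · rw [Function.iterate_succ_apply, hc, iterate_map_zero]
      exact hb0 _ hκ
  have bYa : ∀ j ≤ k, MulBound Φ (Y^[j] (Y a)) κ := fun j hj => by
    simpa only [Function.iterate_succ_apply] using hb (j + 1) (by omega)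
  have hXYa : X (Y a) = 0 := by rw [h.comm, ha, map_zero]
  have hη0 : 0 ≤ 2 ^ k * κ := by positivity
  have hη : 2 ^ k * κ ≤ 1 := by linarith
  have mainX := h.energy_component_le hXX hYX ha hκ k hη hp (itX a ha (hb 0 (Nat.zero_le _)))
    (itX (Y a) hXYa (bYa 0 (Nat.zero_le _))) (bX f₁ x₁) (bX f₂ x₂) ((zX f₁).trans x₁)
    ((zX f₂).trans x₂)
  have mainY := h.energy_component_le h.comm (fun _ => rfl) ha hκ k hη hp
    (fun j hj => hb j (by omega)) bYa (bY f₁ x₁ y₁) (bY f₂ x₂ y₂) (hf₁.trans y₁) (hf₂.trans y₂)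
  rw [Real.sq_sqrt hD0] at mainX mainY
  rw [← hg₁, ← hg₂] at mainX mainY
  have hE : ‖Φ (X^[k] f₁)‖ ^ 2 + ‖Φ (X^[k] f₂)‖ ^ 2 + ‖Φ (Y^[k] f₁)‖ ^ 2 +
      ‖Φ (Y^[k] f₂)‖ ^ 2 ≤ D := by
    have := zX f₁
    have := zX f₂
    rw [hD]
    gcongr
  have t₁ := mul_le_mul_of_nonneg_left hE (sub_nonneg.mpr hδ1)
  have t₂ := mul_le_mul_of_nonneg_right hδ hD0
  linarith

end TorusCalculus

end Abstract

section Wirtinger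

/-- **Wirtinger's inequality** for mean-zero `2π`-periodic functions. -/
theorem wirtinger_inequality {g g' : ℝ → ℝ} (hg : ∀ x, HasDerivAt g (g' x) x)
    (hg' : Continuous g') (hper : g (-π) = g π) (hmean : ∫ x in (-π)..π, g x = 0) :
    ∫ x in (-π)..π, g x ^ 2 ≤ ∫ x in (-π)..π, g' x ^ 2 := by
  have hab : -π < π := by linarith [Real.pi_pos]
  have hgc : Continuous g := continuous_iff_continuousAt.mpr fun x => (hg x).continuousAt
  have memLp : ∀ {h : ℝ → ℝ}, Continuous h →
      MemLp (fun x => (h x : ℂ)) 2 (volume.restrict (Set.Ioc (-π) π)) := by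
    intro h hh
    have hc : Continuous fun x => (h x : ℂ) := Complex.continuous_ofReal.comp hh
    rw [memLp_two_iff_integrable_sq_norm hc.aestronglyMeasurable]
    exact ((hc.norm.pow 2).continuousOn.integrableOn_compact isCompact_Icc).mono_set
      Set.Ioc_subset_Icc_self
  have s := hasSum_sq_fourierCoeffOn hab (memLp hgc)
  have s' := hasSum_sq_fourierCoeffOn hab (memLp hg')
  have key : ∀ n : ℤ, ‖fourierCoeffOn hab (fun x => (g x : ℂ)) n‖ ^ 2 ≤
      ‖fourierCoeffOn hab (fun x => (g' x : ℂ)) n‖ ^ 2 := by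
    intro n
    rcases eq_or_ne n 0 with rfl | hn
    · rw [fourierCoeffOn_eq_integral]
      simp only [neg_zero, fourier_zero, one_smul, intervalIntegral.integral_ofReal, hmean]
      simp only [Complex.ofReal_zero, smul_zero, norm_zero]
      rw [zero_pow two_ne_zero]
      positivity
    · have hd : ∀ x ∈ Set.uIcc (-π) π, HasDerivAt (fun x => (g x : ℂ)) (g' x : ℂ) x :=
        fun x _ => (hg x).ofReal_comp
      rw [fourierCoeffOn_of_hasDerivAt hab hn hd
        ((Complex.continuous_ofReal.comp hg').intervalIntegrable _ _)]
      have hpi : (π : ℂ) ≠ 0 := by exact_mod_cast Real.pi_ne_zero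
      have hn' : (n : ℂ) ≠ 0 := by exact_mod_cast hn
      have e : ∀ z c : ℂ, 1 / (-2 * (π : ℂ) * Complex.I * n) *
          (z * ((g π : ℂ) - g (-π)) - ((π : ℂ) - ((-π : ℝ) : ℂ)) * c) =
          c * (Complex.I * n)⁻¹ := by
        intro z c
        rw [hper]
        push_cast
        field_simp
        ring
      rw [e, norm_mul, norm_inv, norm_mul, Complex.norm_I, one_mul]
      have h1 : (1 : ℝ) ≤ ‖(n : ℂ)‖ := by
        rw [Complex.norm_intCast]
        exact_mod_cast Int.one_le_abs hn
      gcongr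
      exact mul_le_of_le_one_right (norm_nonneg _) (inv_le_one_of_one_le₀ h1)
  have := hasSum_le key s s'
  simp only [Complex.norm_real, Real.norm_eq_abs, sq_abs, smul_eq_mul] at this
  exact le_of_mul_le_mul_left this (inv_pos.mpr (by linarith))

end Wirtinger

section Box

/-- The fundamental domain `[-π, π]²` of the torus. -/
def torusBox : Set (ℝ × ℝ) := Set.Icc (-π) π ×ˢ Set.Icc (-π) π

lemma isCompact_torusBox : IsCompact torusBox := isCompact_Icc.prod isCompact_Icc

lemma Continuous.integrableOn_torusBox {w : ℝ × ℝ → ℝ} (hw : Continuous w) :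
    IntegrableOn w torusBox := hw.continuousOn.integrableOn_compact isCompact_torusBox

lemma setIntegral_torusBox {w : ℝ × ℝ → ℝ} (hw : Continuous w) :
    ∫ x in torusBox, w x = ∫ x₁ in (-π)..π, ∫ x₂ in (-π)..π, w (x₁, x₂) := by
  have hab : -π ≤ π := by linarith [Real.pi_pos]
  have := setIntegral_prod (μ := volume) (ν := volume) w
    (s := Set.Icc (-π) π) (t := Set.Icc (-π) π) hw.integrableOn_torusBox
  simp only [integral_Icc_eq_integral_Ioc] at this
  simp only [intervalIntegral.integral_of_le hab]
  exact this

lemma setIntegral_torusBox_swap {w : ℝ × ℝ → ℝ} (hw : Continuous w) :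
    ∫ x in torusBox, w x = ∫ x₂ in (-π)..π, ∫ x₁ in (-π)..π, w (x₁, x₂) := by
  rw [setIntegral_torusBox hw]
  refine intervalIntegral_intervalIntegral_swap (F := fun x y => w (x, y)) ?_
  have hab : -π ≤ π := by linarith [Real.pi_pos]
  rw [Set.uIoc_of_le hab]
  exact hw.integrableOn_torusBox.mono_set
    (Set.prod_mono Set.Ioc_subset_Icc_self Set.Ioc_subset_Icc_self)

lemma setIntegral_torusBox_le {u v : ℝ × ℝ → ℝ} (hu : Continuous u) (hv : Continuous v)
    (h : ∀ x₁, ∫ x₂ in (-π)..π, u (x₁, x₂) ≤ ∫ x₂ in (-π)..π, v (x₁, x₂)) :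
    ∫ x in torusBox, u x ≤ ∫ x in torusBox, v x := by
  rw [setIntegral_torusBox hu, setIntegral_torusBox hv]
  refine intervalIntegral.integral_mono_on (by linarith [Real.pi_pos])
    (Continuous.intervalIntegrable ?_ _ _) (Continuous.intervalIntegrable ?_ _ _) fun x _ => h x
  · exact intervalIntegral.continuous_parametric_intervalIntegral_of_continuous'
      (f := fun x₁ x₂ => u (x₁, x₂)) (by fun_prop) _ _
  · exact intervalIntegral.continuous_parametric_intervalIntegral_of_continuous'
      (f := fun x₁ x₂ => v (x₁, x₂)) (by fun_prop) _ _

lemma setIntegral_torusBox_le_swap {u v : ℝ × ℝ → ℝ} (hu : Continuous u) (hv : Continuous v)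
    (h : ∀ x₂, ∫ x₁ in (-π)..π, u (x₁, x₂) ≤ ∫ x₁ in (-π)..π, v (x₁, x₂)) :
    ∫ x in torusBox, u x ≤ ∫ x in torusBox, v x := by
  rw [setIntegral_torusBox_swap hu, setIntegral_torusBox_swap hv]
  refine intervalIntegral.integral_mono_on (by linarith [Real.pi_pos])
    (Continuous.intervalIntegrable ?_ _ _) (Continuous.intervalIntegrable ?_ _ _) fun x _ => h x
  · exact intervalIntegral.continuous_parametric_intervalIntegral_of_continuous'
      (f := fun x₂ x₁ => u (x₁, x₂)) (by fun_prop) _ _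
  · exact intervalIntegral.continuous_parametric_intervalIntegral_of_continuous'
      (f := fun x₂ x₁ => v (x₁, x₂)) (by fun_prop) _ _

/-- Differentiation under the integral sign over a compact set. -/
lemma hasDerivAt_setIntegral_of_continuous {X : Type*} [TopologicalSpace X] [T2Space X]
    [SecondCountableTopology X] [MeasurableSpace X] [BorelSpace X] {μ : Measure X}
    [IsFiniteMeasureOnCompacts μ] {S : Set X} (hS : IsCompact S) {G G' : ℝ → X → ℝ}
    (hG : Continuous (Function.uncurry G)) (hG' : Continuous (Function.uncurry G'))
    (hd : ∀ t x, HasDerivAt (fun s => G s x) (G' t x) t) (t : ℝ) :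
    HasDerivAt (fun s => ∫ x in S, G s x ∂μ) (∫ x in S, G' t x ∂μ) t := by
  have hGt : ∀ s, Continuous (G s) := fun s => hG.comp (by fun_prop : Continuous fun x => (s, x))
  have hG't : Continuous (G' t) := hG'.comp (by fun_prop : Continuous fun x => (t, x))
  obtain ⟨C, hC⟩ := ((isCompact_Icc (a := t - 1) (b := t + 1)).prod
    hS).exists_bound_of_continuousOn hG'.continuousOn
  refine (hasDerivAt_integral_of_dominated_loc_of_deriv_le (bound := fun _ => C)
    (Icc_mem_nhds (by linarith : t - 1 < t) (by linarith : t < t + 1))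
    (.of_forall fun s => (hGt s).aestronglyMeasurable)
    ((hGt t).continuousOn.integrableOn_compact hS) hG't.aestronglyMeasurable ?_ ?_ ?_).2
  · refine (ae_restrict_mem hS.measurableSet).mono fun x hx s hs => ?_
    exact hC (s, x) ⟨hs, hx⟩
  · exact continuousOn_const.integrableOn_compact hS
  · exact .of_forall fun x s _ => hd s x

end Box

section DirectionalDerivative

variable {E F : Type*} [NormedAddCommGroup E] [NormedSpace ℝ E] [NormedAddCommGroup F]
  [NormedSpace ℝ F]

/-- The derivative of `u` in the direction `v`. -/
noncomputable def dirDeriv (v : E) (u : E → ℝ) : E → ℝ := fun x => fderiv ℝ u x v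

lemma ContDiff.dirDeriv {u : E → ℝ} (hu : ContDiff ℝ (⊤ : ℕ∞) u) (v : E) :
    ContDiff ℝ (⊤ : ℕ∞) (dirDeriv v u) :=
  (hu.fderiv_right (m := (⊤ : ℕ∞)) (by simp)).clm_apply contDiff_const

lemma ContDiff.iterate_dirDeriv {u : E → ℝ} (hu : ContDiff ℝ (⊤ : ℕ∞) u) (v : E) (k : ℕ) :
    ContDiff ℝ (⊤ : ℕ∞) ((_root_.dirDeriv v)^[k] u) := by
  induction k with
  | zero => exact hu
  | succ k ih => rw [Function.iterate_succ_apply']; exact ih.dirDeriv v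

lemma ContDiff.differentiable_top {u : E → ℝ} (hu : ContDiff ℝ (⊤ : ℕ∞) u) :
    Differentiable ℝ u := hu.differentiable (by simp)

lemma dirDeriv_comm {u : E → ℝ} (hu : ContDiff ℝ (⊤ : ℕ∞) u) (v w : E) :
    dirDeriv v (dirDeriv w u) = dirDeriv w (dirDeriv v u) := by
  have hd : Differentiable ℝ (fderiv ℝ u) :=
    (hu.fderiv_right (m := (⊤ : ℕ∞)) (by simp)).differentiable (by simp)
  have key : ∀ v w x, dirDeriv v (dirDeriv w u) x = fderiv ℝ (fderiv ℝ u) x v w := by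
    intro v w x
    have := (hd x).hasFDerivAt.clm_apply (hasFDerivAt_const w x)
    refine (congrArg (fun B : E →L[ℝ] ℝ => B v) this.fderiv).trans ?_
    simp
  ext x
  rw [key, key]
  exact (hu.contDiffAt.isSymmSndFDerivAt (by
    rw [minSmoothness_of_isRCLikeNormedField]
    exact WithTop.coe_le_coe.2 (le_top : (2 : ℕ∞) ≤ ⊤))) v w

lemma dirDeriv_iterate_comm {u : E → ℝ} (hu : ContDiff ℝ (⊤ : ℕ∞) u) (v w : E) (k : ℕ) :
    dirDeriv v ((dirDeriv w)^[k] u) = (dirDeriv w)^[k] (dirDeriv v u) := by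
  induction k with
  | zero => rfl
  | succ k ih =>
    rw [Function.iterate_succ_apply', Function.iterate_succ_apply',
      dirDeriv_comm (hu.iterate_dirDeriv w k), ih]

/-- Directional derivatives and composition with an affine map. -/
lemma dirDeriv_comp_affine {u : E → ℝ} (hu : ContDiff ℝ (⊤ : ℕ∞) u) (c : E) (A : F →L[ℝ] E)
    (v : F) : dirDeriv v (fun x => u (A x + c)) = fun x => dirDeriv (A v) u (A x + c) := by
  ext x
  have h := ((hu.differentiable_top (A x + c)).hasFDerivAt).comp x (A.hasFDerivAt.add_const c)
  exact congrArg (fun B : F →L[ℝ] ℝ => B v) h.fderiv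

lemma iterate_dirDeriv_comp_affine {u : E → ℝ} (hu : ContDiff ℝ (⊤ : ℕ∞) u) (c : E)
    (A : F →L[ℝ] E) (v : F) (k : ℕ) :
    (dirDeriv v)^[k] (fun x => u (A x + c)) = fun x => (dirDeriv (A v))^[k] u (A x + c) := by
  induction k with
  | zero => rfl
  | succ k ih =>
    rw [Function.iterate_succ_apply', Function.iterate_succ_apply', ih,
      dirDeriv_comp_affine (hu.iterate_dirDeriv _ k)]

lemma hasDerivAt_dirDeriv {u : E → ℝ} (hu : ContDiff ℝ (⊤ : ℕ∞) u) {γ : ℝ → E} {v : E} {s : ℝ}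
    (hγ : HasDerivAt γ v s) : HasDerivAt (fun y => u (γ y)) (dirDeriv v u (γ s)) s :=
  (hu.differentiable_top (γ s)).hasFDerivAt.comp_hasDerivAt s hγ

/-- Iterated derivatives along a line. -/
lemma iteratedDeriv_line {u : E → ℝ} (hu : ContDiff ℝ (⊤ : ℕ∞) u) {γ : ℝ → E} {v : E}
    (hγ : ∀ s, HasDerivAt γ v s) (k : ℕ) :
    iteratedDeriv k (fun y => u (γ y)) = fun s => (dirDeriv v)^[k] u (γ s) := by
  induction k with
  | zero => simp
  | succ k ih =>
    rw [iteratedDeriv_succ, ih, Function.iterate_succ_apply']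
    ext s
    exact (hasDerivAt_dirDeriv (hu.iterate_dirDeriv v k) (hγ s)).deriv

lemma deriv_line {u : E → ℝ} (hu : ContDiff ℝ (⊤ : ℕ∞) u) {γ : ℝ → E} {v : E}
    (hγ : ∀ s, HasDerivAt γ v s) : deriv (fun y => u (γ y)) = fun s => dirDeriv v u (γ s) := by
  ext s
  exact (hasDerivAt_dirDeriv hu (hγ s)).deriv

lemma dirDeriv_periodic {u : E → ℝ} {c : E} (v : E) (hu : ∀ x, u (x + c) = u x) (x : E) :
    dirDeriv v u (x + c) = dirDeriv v u x := by
  have : (fun x => u (x + c)) = u := funext hu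
  have h := fderiv_comp_add_right (𝕜 := ℝ) (f := u) (x := x) c
  rw [this] at h
  simp only [dirDeriv, h]

end DirectionalDerivative

section Torus

/-- Smooth functions on the plane that are `2π`-periodic in each variable. -/
def smoothTorus : Subalgebra ℝ (ℝ × ℝ → ℝ) where
  carrier := {u | ContDiff ℝ (⊤ : ℕ∞) u ∧ (∀ x, u (x + (2 * π, 0)) = u x) ∧
    ∀ x, u (x + (0, 2 * π)) = u x}
  mul_mem' hu hv := ⟨hu.1.mul hv.1, fun x => by simp [hu.2.1 x, hv.2.1 x],
    fun x => by simp [hu.2.2 x, hv.2.2 x]⟩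
  add_mem' hu hv := ⟨hu.1.add hv.1, fun x => by simp [hu.2.1 x, hv.2.1 x],
    fun x => by simp [hu.2.2 x, hv.2.2 x]⟩
  algebraMap_mem' r := ⟨contDiff_const, fun _ => rfl, fun _ => rfl⟩

lemma contDiff_torus (u : smoothTorus) : ContDiff ℝ (⊤ : ℕ∞) (u : ℝ × ℝ → ℝ) := u.2.1

lemma continuous_torus (u : smoothTorus) : Continuous (u : ℝ × ℝ → ℝ) := u.2.1.continuous

lemma periodic_left_torus (u : smoothTorus) (y : ℝ) : u.1 (-π, y) = u.1 (π, y) := by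
  rw [← u.2.2.1 (-π, y), Prod.mk_add_mk, add_zero, show -π + 2 * π = π by ring]

lemma periodic_right_torus (u : smoothTorus) (x : ℝ) : u.1 (x, -π) = u.1 (x, π) := by
  rw [← u.2.2.2 (x, -π), Prod.mk_add_mk, add_zero, show -π + 2 * π = π by ring]

/-- Directional derivatives as derivations of the algebra of smooth periodic functions. -/
noncomputable def torusDeriv (v : ℝ × ℝ) : Derivation ℝ smoothTorus smoothTorus :=
  Derivation.mk'
    { toFun := fun u => ⟨dirDeriv v u.1, (contDiff_torus u).dirDeriv v,
        dirDeriv_periodic v u.2.2.1, dirDeriv_periodic v u.2.2.2⟩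
      map_add' := fun u w => Subtype.ext <| funext fun x => by
        have := fderiv_add ((contDiff_torus u).differentiable_top x)
          ((contDiff_torus w).differentiable_top x)
        exact congrArg (fun B : ℝ × ℝ →L[ℝ] ℝ => B v) this
      map_smul' := fun c u => Subtype.ext <| funext fun x => by
        have := fderiv_const_smul ((contDiff_torus u).differentiable_top x) c
        exact congrArg (fun B : ℝ × ℝ →L[ℝ] ℝ => B v) this }
    fun u w => Subtype.ext <| funext fun x => by
      have := fderiv_mul ((contDiff_torus u).differentiable_top x)
          ((contDiff_torus w).differentiable_top x)
      exact congrArg (fun B : ℝ × ℝ →L[ℝ] ℝ => B v) this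

lemma coe_torusDeriv (v : ℝ × ℝ) (u : smoothTorus) :
    (torusDeriv v u : ℝ × ℝ → ℝ) = dirDeriv v u.1 := rfl

lemma coe_iterate_torusDeriv (v : ℝ × ℝ) (u : smoothTorus) (k : ℕ) :
    ((torusDeriv v)^[k] u : ℝ × ℝ → ℝ) = (dirDeriv v)^[k] u.1 := by
  induction k with
  | zero => rfl
  | succ k ih =>
    rw [Function.iterate_succ_apply', Function.iterate_succ_apply', coe_torusDeriv, ih]

lemma hasDerivAt_horizontal (y s : ℝ) : HasDerivAt (fun x : ℝ => (x, y)) ((1, 0) : ℝ × ℝ) s :=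
  (hasDerivAt_id s).prodMk (hasDerivAt_const s y)

lemma hasDerivAt_vertical (x s : ℝ) : HasDerivAt (fun y : ℝ => (x, y)) ((0, 1) : ℝ × ℝ) s :=
  (hasDerivAt_const s x).prodMk (hasDerivAt_id s)

lemma memLp_torusBox {w : ℝ × ℝ → ℝ} (hw : Continuous w) :
    MemLp w 2 (volume.restrict torusBox) :=
  (memLp_two_iff_integrable_sq hw.aestronglyMeasurable).2 (hw.pow 2).integrableOn_torusBox

/-- The embedding of smooth periodic functions into `L²` of the fundamental domain. -/
noncomputable def torusToL2 : smoothTorus →ₗ[ℝ] Lp ℝ 2 (volume.restrict torusBox) where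
  toFun u := (memLp_torusBox (continuous_torus u)).toLp u.1
  map_add' u v := MemLp.toLp_add (memLp_torusBox (continuous_torus u))
    (memLp_torusBox (continuous_torus v))
  map_smul' c u := MemLp.toLp_const_smul c (memLp_torusBox (continuous_torus u))

lemma coeFn_torusToL2 (u : smoothTorus) : torusToL2 u =ᵐ[volume.restrict torusBox] u.1 :=
  (memLp_torusBox (continuous_torus u)).coeFn_toLp

lemma inner_torusToL2 (u v : smoothTorus) :
    inner ℝ (torusToL2 u) (torusToL2 v) = ∫ x in torusBox, u.1 x * v.1 x := by
  rw [L2.inner_def]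
  refine integral_congr_ae ?_
  filter_upwards [coeFn_torusToL2 u, coeFn_torusToL2 v] with x hu hv
  rw [hu, hv]
  exact mul_comm (v.1 x) (u.1 x)

lemma norm_sq_torusToL2 (u : smoothTorus) :
    ‖torusToL2 u‖ ^ 2 = ∫ x in torusBox, u.1 x ^ 2 := by
  rw [← real_inner_self_eq_norm_sq, inner_torusToL2]
  simp only [sq]

lemma mulBound_torusToL2 {b : smoothTorus} {M : ℝ} (hb : ∀ x, |b.1 x| ≤ M) :
    MulBound torusToL2 b M := by
  intro u
  refine Lp.norm_le_mul_norm_of_ae_le_mul ?_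
  filter_upwards [coeFn_torusToL2 u, coeFn_torusToL2 (b * u)] with x hu hbu
  rw [hu, hbu]
  rw [MulMemClass.coe_mul, Pi.mul_apply, norm_mul]
  exact mul_le_mul_of_nonneg_right (hb x) (norm_nonneg _)

lemma integral_torusDeriv_left (u : smoothTorus) (y : ℝ) :
    ∫ x in (-π)..π, (torusDeriv (1, 0) u).1 (x, y) = 0 := by
  refine (intervalIntegral.integral_eq_sub_of_hasDerivAt (f := fun x => u.1 (x, y))
    (fun x _ => hasDerivAt_dirDeriv (contDiff_torus u) (hasDerivAt_horizontal y x))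
    (((continuous_torus (torusDeriv (1, 0) u)).comp
      (by fun_prop : Continuous fun x : ℝ => (x, y))).intervalIntegrable _ _)).trans ?_
  rw [periodic_left_torus, sub_self]

lemma integral_torusDeriv_right (u : smoothTorus) (x : ℝ) :
    ∫ y in (-π)..π, (torusDeriv (0, 1) u).1 (x, y) = 0 := by
  refine (intervalIntegral.integral_eq_sub_of_hasDerivAt (f := fun y => u.1 (x, y))
    (fun y _ => hasDerivAt_dirDeriv (contDiff_torus u) (hasDerivAt_vertical x y))
    (((continuous_torus (torusDeriv (0, 1) u)).comp
      (by fun_prop : Continuous fun y : ℝ => (x, y))).intervalIntegrable _ _)).trans ?_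
  rw [periodic_right_torus, sub_self]

lemma norm_le_torusDeriv_left (u : smoothTorus)
    (hu : ∀ y, ∫ x in (-π)..π, u.1 (x, y) = 0) :
    ‖torusToL2 u‖ ≤ ‖torusToL2 (torusDeriv (1, 0) u)‖ := by
  refine le_of_sq_le_sq ?_ (norm_nonneg _)
  rw [norm_sq_torusToL2, norm_sq_torusToL2]
  refine setIntegral_torusBox_le_swap ((continuous_torus u).pow 2) ((continuous_torus _).pow 2)
    fun y => ?_
  exact wirtinger_inequality
    (fun x => hasDerivAt_dirDeriv (contDiff_torus u) (hasDerivAt_horizontal y x))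
    ((continuous_torus (torusDeriv (1, 0) u)).comp (by fun_prop : Continuous fun x : ℝ => (x, y)))
    ((periodic_left_torus u) y) (hu y)

lemma norm_le_torusDeriv_right (u : smoothTorus)
    (hu : ∀ x, ∫ y in (-π)..π, u.1 (x, y) = 0) :
    ‖torusToL2 u‖ ≤ ‖torusToL2 (torusDeriv (0, 1) u)‖ := by
  refine le_of_sq_le_sq ?_ (norm_nonneg _)
  rw [norm_sq_torusToL2, norm_sq_torusToL2]
  refine setIntegral_torusBox_le ((continuous_torus u).pow 2) ((continuous_torus _).pow 2)
    fun x => ?_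
  exact wirtinger_inequality
    (fun y => hasDerivAt_dirDeriv (contDiff_torus u) (hasDerivAt_vertical x y))
    ((continuous_torus (torusDeriv (0, 1) u)).comp (by fun_prop : Continuous fun y : ℝ => (x, y)))
    ((periodic_right_torus u) x) (hu x)

lemma skew_of_integral_eq_zero (D : Derivation ℝ smoothTorus smoothTorus)
    (hD : ∀ u, ∫ x in torusBox, (D u).1 x = 0) (u v : smoothTorus) :
    inner ℝ (torusToL2 (D u)) (torusToL2 v) = -inner ℝ (torusToL2 u) (torusToL2 (D v)) := by
  have h := hD (u * v)
  have e : ∀ x, (D (u * v)).1 x = (D u).1 x * v.1 x + u.1 x * (D v).1 x := fun x => by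
    rw [Derivation.leibniz]
    simp only [smul_eq_mul, AddMemClass.coe_add, MulMemClass.coe_mul, Pi.add_apply,
      Pi.mul_apply]
    ring
  simp only [e] at h
  have hs := integral_add ((continuous_torus (D u)).mul (continuous_torus v)).integrableOn_torusBox
    ((continuous_torus u).mul (continuous_torus (D v))).integrableOn_torusBox
  simp only [Pi.mul_apply] at hs
  rw [hs] at h
  rw [inner_torusToL2, inner_torusToL2]
  linarith

lemma torusCalculus : TorusCalculus torusToL2 (torusDeriv (1, 0)) (torusDeriv (0, 1)) where
  comm u := Subtype.ext (dirDeriv_comm (contDiff_torus u) _ _)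
  skew_left := skew_of_integral_eq_zero _ fun u => by
    rw [setIntegral_torusBox_swap (continuous_torus _)]
    simp [integral_torusDeriv_left]
  skew_right := skew_of_integral_eq_zero _ fun u => by
    rw [setIntegral_torusBox (continuous_torus _)]
    simp [integral_torusDeriv_right]
  wirtinger_left u := norm_le_torusDeriv_left _ (integral_torusDeriv_left u)
  wirtinger_right u := norm_le_torusDeriv_right _ (integral_torusDeriv_right u)

end Torus

section TorusLines

lemma iteratedDeriv_horizontal (u : smoothTorus) (k : ℕ) (x y : ℝ) :
    iteratedDeriv k (fun z => u.1 (z, y)) x = ((torusDeriv (1, 0))^[k] u).1 (x, y) := by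
  rw [coe_iterate_torusDeriv]
  exact congrFun (iteratedDeriv_line (contDiff_torus u) (hasDerivAt_horizontal y) k) x

lemma iteratedDeriv_vertical (u : smoothTorus) (k : ℕ) (x y : ℝ) :
    iteratedDeriv k (fun z => u.1 (x, z)) y = ((torusDeriv (0, 1))^[k] u).1 (x, y) := by
  rw [coe_iterate_torusDeriv]
  exact congrFun (iteratedDeriv_line (contDiff_torus u) (hasDerivAt_vertical x) k) y

lemma deriv_horizontal (u : smoothTorus) (y : ℝ) :
    deriv (fun z => u.1 (z, y)) = fun x => (torusDeriv (1, 0) u).1 (x, y) :=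
  deriv_line (contDiff_torus u) (hasDerivAt_horizontal y)

lemma deriv_vertical (u : smoothTorus) (x : ℝ) :
    deriv (fun z => u.1 (x, z)) = fun y => (torusDeriv (0, 1) u).1 (x, y) :=
  deriv_line (contDiff_torus u) (hasDerivAt_vertical x)

lemma integral_torusDeriv_vertical_eq_zero (u : smoothTorus)
    (hu : ∀ y, ∫ x in (-π)..π, u.1 (x, y) = 0) (y : ℝ) :
    ∫ x in (-π)..π, (torusDeriv (0, 1) u).1 (x, y) = 0 := by
  have hab : -π ≤ π := by linarith [Real.pi_pos]
  have h := hasDerivAt_setIntegral_of_continuous (μ := volume) (isCompact_Icc (a := -π) (b := π))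
    (G := fun y x => u.1 (x, y)) (G' := fun y x => (torusDeriv (0, 1) u).1 (x, y))
    ((continuous_torus u).comp continuous_swap)
    ((continuous_torus (torusDeriv (0, 1) u)).comp continuous_swap)
    (fun y x => hasDerivAt_dirDeriv (contDiff_torus u) (hasDerivAt_vertical x y)) y
  simp only [integral_Icc_eq_integral_Ioc, ← intervalIntegral.integral_of_le hab, hu] at h
  exact h.unique (hasDerivAt_const y 0)

lemma integral_iterate_torusDeriv_vertical_eq_zero (u : smoothTorus)
    (hu : ∀ y, ∫ x in (-π)..π, u.1 (x, y) = 0) (k : ℕ) (y : ℝ) :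
    ∫ x in (-π)..π, ((torusDeriv (0, 1))^[k] u).1 (x, y) = 0 := by
  induction k generalizing y with
  | zero => exact hu y
  | succ k ih =>
    rw [Function.iterate_succ_apply']
    exact integral_torusDeriv_vertical_eq_zero _ ih y

lemma norm_iterate_le_of_integral_eq_zero (u : smoothTorus)
    (hu : ∀ y, ∫ x in (-π)..π, u.1 (x, y) = 0) (k : ℕ) :
    ‖torusToL2 ((torusDeriv (0, 1))^[k] u)‖ ≤
      ‖torusToL2 (torusDeriv (1, 0) ((torusDeriv (0, 1))^[k] u))‖ :=
  norm_le_torusDeriv_left _ (integral_iterate_torusDeriv_vertical_eq_zero u hu k)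

end TorusLines

section Family

/-- A smooth function of `(x₁, x₂, t)` that is `2π`-periodic in `x₁` and `x₂`. -/
structure PeriodicFamily (F : ℝ × ℝ × ℝ → ℝ) : Prop where
  contDiff : ContDiff ℝ (⊤ : ℕ∞) F
  periodic_left : ∀ q, F (q + (2 * π, 0, 0)) = F q
  periodic_right : ∀ q, F (q + (0, 2 * π, 0)) = F q

namespace PeriodicFamily

variable {F : ℝ × ℝ × ℝ → ℝ}

lemma of_curried {f : ℝ → ℝ → ℝ → ℝ}
    (hf : ContDiff ℝ (⊤ : ℕ∞) fun q : ℝ × ℝ × ℝ => f q.1 q.2.1 q.2.2)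
    (hp : ∀ x₁ x₂ t, f (x₁ + 2 * π) x₂ t = f x₁ x₂ t ∧ f x₁ (x₂ + 2 * π) t = f x₁ x₂ t) :
    PeriodicFamily fun q => f q.1 q.2.1 q.2.2 where
  contDiff := hf
  periodic_left q := by simpa using (hp q.1 q.2.1 q.2.2).1
  periodic_right q := by simpa using (hp q.1 q.2.1 q.2.2).2

lemma dirDeriv (hF : PeriodicFamily F) (v : ℝ × ℝ × ℝ) : PeriodicFamily (dirDeriv v F) where
  contDiff := hF.contDiff.dirDeriv v
  periodic_left := dirDeriv_periodic v hF.periodic_left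
  periodic_right := dirDeriv_periodic v hF.periodic_right

/-- The function of space obtained by freezing the time. -/
def slice (hF : PeriodicFamily F) (t : ℝ) : smoothTorus :=
  ⟨fun x => F (x.1, x.2, t), hF.contDiff.comp (by fun_prop),
    fun x => by simpa using hF.periodic_left (x.1, x.2, t),
    fun x => by simpa using hF.periodic_right (x.1, x.2, t)⟩

lemma iterate_torusDeriv_slice (hF : PeriodicFamily F) (t : ℝ) (v : ℝ × ℝ) (k : ℕ) (x : ℝ × ℝ) :
    ((torusDeriv v)^[k] (hF.slice t)).1 x =
      (_root_.dirDeriv (v.1, v.2, 0))^[k] F (x.1, x.2, t) := by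
  rw [coe_iterate_torusDeriv]
  have h := congrFun (iterate_dirDeriv_comp_affine hF.contDiff (0, 0, t)
    ((ContinuousLinearMap.fst ℝ ℝ ℝ).prod ((ContinuousLinearMap.snd ℝ ℝ ℝ).prod 0)) v k) x
  simpa [slice] using h

/-- Time derivative of the squared `L²` norm of a pure spatial derivative. -/
lemma hasDerivAt_norm_sq (hF : PeriodicFamily F) (v : ℝ × ℝ) (k : ℕ) (t : ℝ) :
    HasDerivAt (fun s => ‖torusToL2 ((torusDeriv v)^[k] (hF.slice s))‖ ^ 2)
      (2 * inner ℝ (torusToL2 ((torusDeriv v)^[k] (hF.slice t)))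
        (torusToL2 ((torusDeriv v)^[k] ((hF.dirDeriv (0, 0, 1)).slice t)))) t := by
  simp only [norm_sq_torusToL2, inner_torusToL2, iterate_torusDeriv_slice,
    ← dirDeriv_iterate_comm hF.contDiff]
  rw [← integral_const_mul]
  have hG := hF.contDiff.iterate_dirDeriv (v.1, v.2, 0) k
  have hG' := hG.dirDeriv (0, 0, 1)
  set G := (_root_.dirDeriv (v.1, v.2, 0))^[k] F
  have hl : Continuous fun q : ℝ × (ℝ × ℝ) => (q.2.1, q.2.2, q.1) := by fun_prop
  refine hasDerivAt_setIntegral_of_continuous isCompact_torusBox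
    (G := fun s x => G (x.1, x.2, s) ^ 2)
    (G' := fun s x => 2 * (G (x.1, x.2, s) * _root_.dirDeriv (0, 0, 1) G (x.1, x.2, s)))
    ((continuous_pow 2).comp (hG.continuous.comp hl))
    ((continuous_const_mul (2 : ℝ)).comp
      ((hG.continuous.comp hl).mul (hG'.continuous.comp hl))) ?_ t
  intro s x
  have := hasDerivAt_dirDeriv hG ((hasDerivAt_const s x.1).prodMk
    ((hasDerivAt_const s x.2).prodMk (hasDerivAt_id s)))
  simpa [mul_assoc] using this.fun_pow 2

lemma deriv_time (hF : PeriodicFamily F) (x₁ x₂ t : ℝ) :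
    deriv (fun s => F (x₁, x₂, s)) t = ((hF.dirDeriv (0, 0, 1)).slice t).1 (x₁, x₂) :=
  (hasDerivAt_dirDeriv hF.contDiff ((hasDerivAt_const t x₁).prodMk
    ((hasDerivAt_const t x₂).prodMk (hasDerivAt_id t)))).deriv

end PeriodicFamily

/-- Grönwall's inequality in differential form. -/
lemma le_exp_mul_of_hasDerivAt {E E' : ℝ → ℝ} {c T : ℝ} (hE : ∀ t, HasDerivAt E (E' t) t)
    (h : ∀ t ∈ Set.Icc 0 T, E' t ≤ c * E t) {t : ℝ} (ht : t ∈ Set.Icc 0 T) :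
    E t ≤ Real.exp (c * t) * E 0 := by
  have hd : ∀ s, HasDerivAt (fun s => Real.exp (-c * s) * E s)
      (Real.exp (-c * s) * (E' s - c * E s)) s := fun s => by
    refine ((((hasDerivAt_id s).const_mul (-c)).exp).mul (hE s)).congr_deriv ?_
    simp only [id]
    ring
  have anti : AntitoneOn (fun s => Real.exp (-c * s) * E s) (Set.Icc 0 T) := by
    refine antitoneOn_of_deriv_nonpos (convex_Icc 0 T)
      (fun s _ => (hd s).continuousAt.continuousWithinAt)
      (fun s _ => (hd s).differentiableAt.differentiableWithinAt) fun s hs => ?_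
    rw [(hd s).deriv]
    exact mul_nonpos_of_nonneg_of_nonpos (Real.exp_pos _).le
      (sub_nonpos.mpr (h s (interior_subset hs)))
  have key := anti ⟨le_rfl, ht.1.trans ht.2⟩ ht ht.1
  simp only [mul_zero, Real.exp_zero, one_mul] at key
  calc E t = Real.exp (c * t) * (Real.exp (-c * t) * E t) := by
        rw [← mul_assoc, ← Real.exp_add]
        simp
    _ ≤ _ := mul_le_mul_of_nonneg_left key (Real.exp_pos _).le

end Family

section Energy

/-- The squared homogeneous Sobolev norm of order `k` of the vector field `(u, v)`. -/
noncomputable def torusEnergy (k : ℕ) (u v : smoothTorus) : ℝ :=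
  ‖torusToL2 ((torusDeriv (1, 0))^[k] u)‖ ^ 2 + ‖torusToL2 ((torusDeriv (1, 0))^[k] v)‖ ^ 2 +
    ‖torusToL2 ((torusDeriv (0, 1))^[k] u)‖ ^ 2 + ‖torusToL2 ((torusDeriv (0, 1))^[k] v)‖ ^ 2

lemma torusEnergy_eq_integral (k : ℕ) (u v : smoothTorus) :
    torusEnergy k u v = ∫ x₂ in (-π)..π, ∫ x₁ in (-π)..π,
      (iteratedDeriv k (fun y => u.1 (y, x₂)) x₁ ^ 2
        + iteratedDeriv k (fun y => v.1 (y, x₂)) x₁ ^ 2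
        + iteratedDeriv k (fun y => u.1 (x₁, y)) x₂ ^ 2
        + iteratedDeriv k (fun y => v.1 (x₁, y)) x₂ ^ 2) := by
  have hadd : ∀ p q : ℝ × ℝ → ℝ, Continuous p → Continuous q →
      ∫ x in torusBox, (p x + q x) = (∫ x in torusBox, p x) + ∫ x in torusBox, q x :=
    fun p q hp hq => integral_add hp.integrableOn_torusBox hq.integrableOn_torusBox
  have hc : ∀ w : smoothTorus, Continuous fun x => w.1 x ^ 2 := fun w =>
    (continuous_torus w).pow 2
  simp only [iteratedDeriv_horizontal, iteratedDeriv_vertical]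
  rw [← setIntegral_torusBox_swap (w := fun x => ((torusDeriv (1, 0))^[k] u).1 x ^ 2
      + ((torusDeriv (1, 0))^[k] v).1 x ^ 2 + ((torusDeriv (0, 1))^[k] u).1 x ^ 2
      + ((torusDeriv (0, 1))^[k] v).1 x ^ 2) ((((hc _).add (hc _)).add (hc _)).add (hc _)),
    hadd, hadd, hadd]
  · simp only [torusEnergy, norm_sq_torusToL2]
  exacts [hc _, hc _, (hc _).add (hc _), hc _, ((hc _).add (hc _)).add (hc _), hc _]

lemma PeriodicFamily.hasDerivAt_torusEnergy {F G : ℝ × ℝ × ℝ → ℝ} (hF : PeriodicFamily F)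
    (hG : PeriodicFamily G) (k : ℕ) (t : ℝ) :
    HasDerivAt (fun s => torusEnergy k (hF.slice s) (hG.slice s))
      (2 * (inner ℝ (torusToL2 ((torusDeriv (1, 0))^[k] (hF.slice t)))
          (torusToL2 ((torusDeriv (1, 0))^[k] ((hF.dirDeriv (0, 0, 1)).slice t)))
        + inner ℝ (torusToL2 ((torusDeriv (1, 0))^[k] (hG.slice t)))
          (torusToL2 ((torusDeriv (1, 0))^[k] ((hG.dirDeriv (0, 0, 1)).slice t)))
        + inner ℝ (torusToL2 ((torusDeriv (0, 1))^[k] (hF.slice t)))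
          (torusToL2 ((torusDeriv (0, 1))^[k] ((hF.dirDeriv (0, 0, 1)).slice t)))
        + inner ℝ (torusToL2 ((torusDeriv (0, 1))^[k] (hG.slice t)))
          (torusToL2 ((torusDeriv (0, 1))^[k] ((hG.dirDeriv (0, 0, 1)).slice t))))) t := by
  have h := (((hF.hasDerivAt_norm_sq (1, 0) k t).add (hG.hasDerivAt_norm_sq (1, 0) k t)).add
    (hF.hasDerivAt_norm_sq (0, 1) k t)).add (hG.hasDerivAt_norm_sq (0, 1) k t)
  exact h.congr_deriv (by ring)

end Energy

section VerticalFunctions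

/-- A smooth periodic function of `x₂` and `t`, frozen in time, as a function on the torus. -/
def verticalSlice {a : ℝ → ℝ → ℝ} (ha : ContDiff ℝ (⊤ : ℕ∞) fun q : ℝ × ℝ => a q.1 q.2)
    (hp : ∀ x₂ t, a (x₂ + 2 * π) t = a x₂ t) (t : ℝ) : smoothTorus :=
  ⟨fun x => a x.2 t,
    ha.comp (by fun_prop : ContDiff ℝ (⊤ : ℕ∞) fun x : ℝ × ℝ => (x.2, t)),
    fun x => by simp, fun x => by simpa using hp x.2 t⟩

variable {a : ℝ → ℝ → ℝ} (ha : ContDiff ℝ (⊤ : ℕ∞) fun q : ℝ × ℝ => a q.1 q.2)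
  (hp : ∀ x₂ t, a (x₂ + 2 * π) t = a x₂ t) (t : ℝ)

lemma torusDeriv_verticalSlice : torusDeriv (1, 0) (verticalSlice ha hp t) = 0 :=
  Subtype.ext <| funext fun x =>
    (congrFun (deriv_horizontal (verticalSlice ha hp t) x.2) x.1).symm.trans
      (deriv_const x.1 (a x.2 t))

lemma mulBound_iterate_verticalSlice {j : ℕ} {M : ℝ}
    (hb : ∀ x₂, |iteratedDeriv j (fun y => a y t) x₂| ≤ M) :
    MulBound torusToL2 ((torusDeriv (0, 1))^[j] (verticalSlice ha hp t)) M :=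
  mulBound_torusToL2 fun x => by
    rw [← iteratedDeriv_vertical (verticalSlice ha hp t) j x.1 x.2]
    exact hb x.2

end VerticalFunctions

/-- Linear decay estimate for the linearization of the 2D magnetic relaxation equations
(γ = 0) around `B = e₁`: for `k ≥ 4` and `δ ∈ (0,1)` there is `ε₀ > 0` such that if the
first `k+1` derivatives of `a` are bounded by `4ε` with `0 < ε ≤ ε₀`, `−Δp_L = 2 ∂₂a ∂₁f₂`,
and `f` is a periodic divergence-free solution with vanishing `x₁`-average of
`∂ₜ f = (1+a)² ∂₁²f + (1+a) ∇∂₁p_L − (∂₂a ∂₂p_L) e₁` on `[0,T]`, then the `Ḣᵏ`-type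
energy `E(t) = ∫ |∂₁ᵏf|² + |∂₂ᵏf|²` satisfies `E(t) ≤ e^{−2(1−δ)t} E(0)`. -/
theorem stmt_7 (k : ℕ) (hk : 4 ≤ k) (δ : ℝ) (hδ : δ ∈ Set.Ioo (0 : ℝ) 1) :
    ∃ ε₀ : ℝ, 0 < ε₀ ∧
    ∀ ε : ℝ, 0 < ε → ε ≤ ε₀ → ∀ T : ℝ, 0 < T →
    ∀ a : ℝ → ℝ → ℝ, ∀ pL f₁ f₂ : ℝ → ℝ → ℝ → ℝ,
    ContDiff ℝ (⊤ : ℕ∞) (fun q : ℝ × ℝ => a q.1 q.2) →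
    (∀ x₂ t : ℝ, a (x₂ + 2 * π) t = a x₂ t) →
    (∀ j : ℕ, j ≤ k + 1 → ∀ x₂ : ℝ, ∀ t ∈ Set.Icc (0 : ℝ) T,
      |iteratedDeriv j (fun y => a y t) x₂| ≤ 4 * ε) →
    ContDiff ℝ (⊤ : ℕ∞) (fun q : ℝ × ℝ × ℝ => pL q.1 q.2.1 q.2.2) →
    ContDiff ℝ (⊤ : ℕ∞) (fun q : ℝ × ℝ × ℝ => f₁ q.1 q.2.1 q.2.2) →
    ContDiff ℝ (⊤ : ℕ∞) (fun q : ℝ × ℝ × ℝ => f₂ q.1 q.2.1 q.2.2) →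
    (∀ ψ ∈ [pL, f₁, f₂], ∀ x₁ x₂ t : ℝ,
      ψ (x₁ + 2 * π) x₂ t = ψ x₁ x₂ t ∧ ψ x₁ (x₂ + 2 * π) t = ψ x₁ x₂ t) →
    (∀ t ∈ Set.Icc (0 : ℝ) T, (∫ x₂ in (-π)..π, ∫ x₁ in (-π)..π, pL x₁ x₂ t) = 0) →
    (∀ x₁ x₂ : ℝ, ∀ t ∈ Set.Icc (0 : ℝ) T,
      -(deriv (deriv (fun y => pL y x₂ t)) x₁ + deriv (deriv (fun y => pL x₁ y t)) x₂)
        = 2 * deriv (fun y => a y t) x₂ * deriv (fun y => f₂ y x₂ t) x₁) →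
    (∀ x₁ x₂ : ℝ, ∀ t ∈ Set.Icc (0 : ℝ) T,
      deriv (fun y => f₁ y x₂ t) x₁ + deriv (fun y => f₂ x₁ y t) x₂ = 0) →
    (∀ x₂ : ℝ, ∀ t ∈ Set.Icc (0 : ℝ) T,
      (∫ x₁ in (-π)..π, f₁ x₁ x₂ t) = 0 ∧ (∫ x₁ in (-π)..π, f₂ x₁ x₂ t) = 0) →
    (∀ x₁ x₂ : ℝ, ∀ t ∈ Set.Icc (0 : ℝ) T,
      deriv (fun s => f₁ x₁ x₂ s) t =
        (1 + a x₂ t) ^ 2 * deriv (deriv (fun y => f₁ y x₂ t)) x₁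
          + (1 + a x₂ t) * deriv (deriv (fun y => pL y x₂ t)) x₁
          - deriv (fun y => a y t) x₂ * deriv (fun y => pL x₁ y t) x₂ ∧
      deriv (fun s => f₂ x₁ x₂ s) t =
        (1 + a x₂ t) ^ 2 * deriv (deriv (fun y => f₂ y x₂ t)) x₁
          + (1 + a x₂ t) * deriv (fun y₂ => deriv (fun z => pL z y₂ t) x₁) x₂) →
    ∀ t ∈ Set.Icc (0 : ℝ) T,
      (∫ x₂ in (-π)..π, ∫ x₁ in (-π)..π,
          ((iteratedDeriv k (fun y => f₁ y x₂ t) x₁) ^ 2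
            + (iteratedDeriv k (fun y => f₂ y x₂ t) x₁) ^ 2
            + (iteratedDeriv k (fun y => f₁ x₁ y t) x₂) ^ 2
            + (iteratedDeriv k (fun y => f₂ x₁ y t) x₂) ^ 2))
        ≤ Real.exp (-2 * (1 - δ) * t) *
          (∫ x₂ in (-π)..π, ∫ x₁ in (-π)..π,
            ((iteratedDeriv k (fun y => f₁ y x₂ 0) x₁) ^ 2
              + (iteratedDeriv k (fun y => f₂ y x₂ 0) x₁) ^ 2
              + (iteratedDeriv k (fun y => f₁ x₁ y 0) x₂) ^ 2
              + (iteratedDeriv k (fun y => f₂ x₁ y 0) x₂) ^ 2)) := by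
  obtain ⟨hδ0, hδ1⟩ := hδ
  refine ⟨δ / (144 * 2 ^ k), by positivity, ?_⟩
  intro ε hε hεle T _ a pL f₁ f₂ ha hap hab hpL hf₁ hf₂ hper _ hpress _ hzero hpde t ht
  have P := PeriodicFamily.of_curried hpL (hper pL (by simp))
  have F₁ := PeriodicFamily.of_curried hf₁ (hper f₁ (by simp))
  have F₂ := PeriodicFamily.of_curried hf₂ (hper f₂ (by simp))
  have hsmall : 36 * (2 ^ k * (4 * ε)) ≤ δ := by
    rw [le_div_iff₀ (by positivity)] at hεle
    linarith
  refine (torusEnergy_eq_integral k (F₁.slice t) (F₂.slice t)).symm.trans_le (le_trans ?_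
    (congrArg _ (torusEnergy_eq_integral k (F₁.slice 0) (F₂.slice 0))).le)
  refine le_exp_mul_of_hasDerivAt (F₁.hasDerivAt_torusEnergy F₂ k) (fun s hs => ?_) ht
  have XX : ∀ (u : smoothTorus) x y, deriv (deriv fun z => u.1 (z, y)) x =
      (torusDeriv (1, 0) (torusDeriv (1, 0) u)).1 (x, y) := fun u x y => by
    rw [deriv_horizontal, deriv_horizontal]
  have YY : ∀ (u : smoothTorus) x y, deriv (deriv fun z => u.1 (x, z)) y =
      (torusDeriv (0, 1) (torusDeriv (0, 1) u)).1 (x, y) := fun u x y => by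
    rw [deriv_vertical, deriv_vertical]
  have YX : ∀ (u : smoothTorus) x y, deriv (fun w => deriv (fun z => u.1 (z, w)) x) y =
      (torusDeriv (0, 1) (torusDeriv (1, 0) u)).1 (x, y) := fun u x y => by
    simp only [deriv_horizontal, deriv_vertical]
  have key := torusCalculus.dissipation (a := verticalSlice ha hap s) (f₁ := F₁.slice s)
    (f₂ := F₂.slice s) (p := P.slice s) (k := k) (g₁ := (F₁.dirDeriv (0, 0, 1)).slice s)
    (g₂ := (F₂.dirDeriv (0, 0, 1)).slice s) (torusDeriv_verticalSlice ha hap s)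
    (by positivity : 0 ≤ 4 * ε) (by omega) hsmall hδ1.le ?_
    (fun j hj => mulBound_iterate_verticalSlice ha hap s fun y => hab j hj y s hs)
    (norm_iterate_le_of_integral_eq_zero _ (fun y => (hzero y s hs).1) k)
    (norm_iterate_le_of_integral_eq_zero _ (fun y => (hzero y s hs).2) k) ?_ ?_
  · rw [torusEnergy]
    linarith
  · refine Subtype.ext (funext fun x => ?_)
    have h := hpress x.1 x.2 s hs
    have h1 := XX (P.slice s) x.1 x.2
    have h2 := YY (P.slice s) x.1 x.2
    have h3 := congrFun (deriv_vertical (verticalSlice ha hap s) x.1) x.2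
    have h4 := congrFun (deriv_horizontal (F₂.slice s) x.2) x.1
    simp only [PeriodicFamily.slice, verticalSlice] at h1 h2 h3 h4
    rw [h1, h2, h3, h4, mul_assoc] at h
    exact h
  · refine Subtype.ext (funext fun x => ?_)
    have h := (hpde x.1 x.2 s hs).1
    have h0 := F₁.deriv_time x.1 x.2 s
    have h1 := XX (P.slice s) x.1 x.2
    have h2 := XX (F₁.slice s) x.1 x.2
    have h3 := congrFun (deriv_vertical (verticalSlice ha hap s) x.1) x.2
    have h4 := congrFun (deriv_vertical (P.slice s) x.1) x.2
    simp only [PeriodicFamily.slice, verticalSlice] at h0 h1 h2 h3 h4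
    rw [h0, h1, h2, h3, h4] at h
    exact h
  · refine Subtype.ext (funext fun x => ?_)
    have h := (hpde x.1 x.2 s hs).2
    have h0 := F₂.deriv_time x.1 x.2 s
    have h1 := YX (P.slice s) x.1 x.2
    have h2 := XX (F₂.slice s) x.1 x.2
    simp only [PeriodicFamily.slice] at h0 h1 h2
    rw [h0, h1, h2] at h
    exact h
end

section
/- Let V : ℝ → ℝ be continuously differentiable and let g : ℝ² × ℝ → ℝ be smooth (C^∞) satisfying ∂_t g = V(x₂)² ∂₁² g everywhere. Define B, u : ℝ³ × ℝ → ℝ³ by B(x,t) := (V(x₂), 0, g(x₁,x₂,t)) and u(x,t) := (0, 0, V(x₂) ∂₁g(x₁,x₂,t)). Then div B = 0, div u = 0, u = (B·∇)B, and ∂_t B + (u·∇)B = (B·∇)u hold everywhere. In particular (B,u) is an exact solution of the three-dimensional magnetic relaxation equations with γ = 0 and constant pressure. -/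
open Real Filter MeasureTheory

theorem fderiv_apply_single_eq_deriv_update {ι : Type*} [Fintype ι] [DecidableEq ι]
    {F : (ι → ℝ) → ℝ} {x : ι → ℝ} (hF : DifferentiableAt ℝ F x) (j : ι) :
    fderiv ℝ F x (Pi.single j 1) = deriv (fun s => F (Function.update x j s)) (x j) := by
  have h := hasDerivAt_update x j (x j)
  have hF' : HasFDerivAt F (fderiv ℝ F x) (Function.update x j (x j)) := by
    simpa using hF.hasFDerivAt
  exact (hF'.comp_hasDerivAt (x j) h).deriv.symm

theorem differentiable_deriv_fst_slice {g : ℝ → ℝ → ℝ → ℝ}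
    (hg : ContDiff ℝ 2 (fun q : ℝ × ℝ × ℝ => g q.1 q.2.1 q.2.2)) :
    Differentiable ℝ (fun q : ℝ × ℝ × ℝ => deriv (fun y => g y q.2.1 q.2.2) q.1) := by
  have h : (fun q : ℝ × ℝ × ℝ => deriv (fun y => g y q.2.1 q.2.2) q.1) =
      fun q => fderiv ℝ (fun q : ℝ × ℝ × ℝ => g q.1 q.2.1 q.2.2) q (1, 0, 0) := by
    funext q
    have hslice : HasDerivAt (fun y : ℝ => (y, q.2.1, q.2.2)) (1, 0, 0) q.1 :=
      (hasDerivAt_id _).prodMk ((hasDerivAt_const _ _).prodMk (hasDerivAt_const _ _))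
    exact ((hg.differentiable (by norm_num) q).hasFDerivAt.comp_hasDerivAt q.1 hslice).deriv
  rw [h]
  exact ((hg.fderiv_right (m := 1) (by norm_num)).differentiable (by norm_num)).clm_apply
    (differentiable_const _)

/-- Two-and-a-half dimensional exact solutions of the 3D magnetic relaxation equations
with γ = 0 built from a shear flow: if `∂ₜg = V(x₂)² ∂₁²g`, then
`B = (V(x₂), 0, g(x₁,x₂,t))` and `u = (0, 0, V(x₂) ∂₁g)` satisfy `div B = div u = 0`,
the constitutive law `u = (B·∇)B` (constant pressure), and the frozen-field equation
`∂ₜB + (u·∇)B = (B·∇)u`. -/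
theorem stmt_11 (V : ℝ → ℝ) (g : ℝ → ℝ → ℝ → ℝ)
    (hV : ContDiff ℝ 1 V)
    (hg : ContDiff ℝ (⊤ : ℕ∞) (fun q : ℝ × ℝ × ℝ => g q.1 q.2.1 q.2.2))
    (heq : ∀ x₁ x₂ t : ℝ,
      deriv (fun s => g x₁ x₂ s) t = V x₂ ^ 2 * deriv (deriv (fun y => g y x₂ t)) x₁)
    (B u : (Fin 3 → ℝ) → ℝ → Fin 3 → ℝ)
    (hB : ∀ (x : Fin 3 → ℝ) (t : ℝ), B x t = ![V (x 1), 0, g (x 0) (x 1) t])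
    (hu : ∀ (x : Fin 3 → ℝ) (t : ℝ),
      u x t = ![0, 0, V (x 1) * deriv (fun y => g y (x 1) t) (x 0)]) :
    (∀ (x : Fin 3 → ℝ) (t : ℝ),
      ∑ j : Fin 3, fderiv ℝ (fun y => B y t j) x (Pi.single j 1) = 0) ∧
    (∀ (x : Fin 3 → ℝ) (t : ℝ),
      ∑ j : Fin 3, fderiv ℝ (fun y => u y t j) x (Pi.single j 1) = 0) ∧
    (∀ (x : Fin 3 → ℝ) (t : ℝ) (i : Fin 3),
      u x t i = ∑ j : Fin 3, B x t j * fderiv ℝ (fun y => B y t i) x (Pi.single j 1)) ∧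
    (∀ (x : Fin 3 → ℝ) (t : ℝ) (i : Fin 3),
      deriv (fun s => B x s i) t
          + ∑ j : Fin 3, u x t j * fderiv ℝ (fun y => B y t i) x (Pi.single j 1)
        = ∑ j : Fin 3, B x t j * fderiv ℝ (fun y => u y t i) x (Pi.single j 1)) := by
  have hg2 : ContDiff ℝ 2 (fun q : ℝ × ℝ × ℝ => g q.1 q.2.1 q.2.2) :=
    contDiff_infty.1 hg 2
  have hslice (t : ℝ) : Differentiable ℝ (fun y : Fin 3 → ℝ => (y 0, y 1, t)) := by fun_prop
  have dV : Differentiable ℝ (fun y : Fin 3 → ℝ => V (y 1)) :=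
    (hV.differentiable one_ne_zero).comp (differentiable_apply 1)
  have dg (t : ℝ) : Differentiable ℝ (fun y : Fin 3 → ℝ => g (y 0) (y 1) t) :=
    (hg2.differentiable two_ne_zero).comp (hslice t)
  have du (t : ℝ) : Differentiable ℝ
      (fun y : Fin 3 → ℝ => V (y 1) * deriv (fun z => g z (y 1) t) (y 0)) :=
    dV.mul ((differentiable_deriv_fst_slice hg2).comp (hslice t))
  have pV (x : Fin 3 → ℝ) (j : Fin 3) := fderiv_apply_single_eq_deriv_update (dV x) j
  have pg (t : ℝ) (x : Fin 3 → ℝ) (j : Fin 3) :=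
    fderiv_apply_single_eq_deriv_update (dg t x) j
  have pu (t : ℝ) (x : Fin 3 → ℝ) (j : Fin 3) :=
    fderiv_apply_single_eq_deriv_update (du t x) j
  refine ⟨fun x t => ?_, fun x t => ?_, fun x t i => ?_, fun x t i => ?_⟩
  · simp [Fin.sum_univ_three, hB, pV, pg]
  · simp [Fin.sum_univ_three, hu, pu]
  · fin_cases i <;> simp [Fin.sum_univ_three, hB, hu, pV, pg]
  · fin_cases i <;> simp [Fin.sum_univ_three, hB, hu, pV, pg, pu, heq]
    ring
end

section
/- Let V : ℝ → ℝ be continuous, let g₀ : ℝ → ℝ be continuously differentiable and 2π-periodic, let λ > 0 and c ∈ ℝ with −g₀'' = λ²(g₀ − c), and set g(x₁,x₂,t) := c + exp(−λ² V(x₂)² t)(g₀(x₁) − c) and u₃(x₁,x₂,t) := V(x₂) ∂₁g(x₁,x₂,t) = V(x₂) exp(−λ² V(x₂)² t) g₀'(x₁). Then: (i) for every (x₁,x₂), as t → ∞, g(x₁,x₂,t) → c if V(x₂) ≠ 0, while g(x₁,x₂,t) = g₀(x₁) for all t if V(x₂) = 0; and (ii) sup_{(x₁,x₂) ∈ ℝ²}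 |u₃(x₁,x₂,t)| → 0 as t → ∞. -/
open Real Filter MeasureTheory

/-- The derivative of a periodic function is periodic. -/
theorem periodic_deriv {f : ℝ → ℝ} {T : ℝ} (hf : Function.Periodic f T) :
    Function.Periodic (deriv f) T := fun x => by
  rw [← deriv_comp_add_const, funext hf]

theorem mul_exp_neg_sq_le_one (s : ℝ) : s * Real.exp (-s ^ 2) ≤ 1 := by
  rw [Real.exp_neg, ← div_eq_mul_inv, div_le_one (Real.exp_pos _)]
  nlinarith [Real.add_one_le_exp (s ^ 2), sq_nonneg (s - 1)]

theorem abs_mul_exp_neg_mul_sq_le {lam t : ℝ} (hlam : 0 < lam) (ht : 0 < t) (v : ℝ) :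
    |v| * Real.exp (-(lam ^ 2) * v ^ 2 * t) ≤ (lam * √t)⁻¹ := by
  have hpos : 0 < lam * √t := mul_pos hlam (Real.sqrt_pos.2 ht)
  have h := mul_exp_neg_sq_le_one (lam * √t * |v|)
  have hexp : -(lam * √t * |v|) ^ 2 = -(lam ^ 2) * v ^ 2 * t := by
    rw [mul_pow, mul_pow, Real.sq_sqrt ht.le, sq_abs]
    ring
  rw [hexp] at h
  rw [← one_div, le_div_iff₀ hpos]
  linarith

/-- Magnetic relaxation in the weak (pointwise) topology for the explicit shear-flow
solution: with `g(x₁,x₂,t) = c + exp(−λ² V(x₂)² t)(g₀(x₁) − c)` and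
`u₃ = V(x₂) ∂₁g = V(x₂) exp(−λ² V(x₂)² t) g₀'(x₁)`, the field `g` converges pointwise
as `t → ∞` to `c` where `V(x₂) ≠ 0` (and is constantly `g₀(x₁)` where `V(x₂) = 0`),
while `u₃` converges uniformly to zero. -/
theorem stmt_12 (V : ℝ → ℝ) (hV : Continuous V)
    (g₀ : ℝ → ℝ) (hg₀ : ContDiff ℝ 1 g₀) (hg₀per : ∀ x : ℝ, g₀ (x + 2 * π) = g₀ x)
    (lam : ℝ) (hlam : 0 < lam) (c : ℝ)
    (heig : ∀ x₁ : ℝ, -(deriv (deriv g₀) x₁) = lam ^ 2 * (g₀ x₁ - c))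
    (g u₃ : ℝ → ℝ → ℝ → ℝ)
    (hg : ∀ x₁ x₂ t : ℝ,
      g x₁ x₂ t = c + Real.exp (-(lam ^ 2) * V x₂ ^ 2 * t) * (g₀ x₁ - c))
    (hu₃ : ∀ x₁ x₂ t : ℝ, u₃ x₁ x₂ t = V x₂ * deriv (fun y => g y x₂ t) x₁) :
    (∀ x₁ x₂ t : ℝ,
      u₃ x₁ x₂ t = V x₂ * Real.exp (-(lam ^ 2) * V x₂ ^ 2 * t) * deriv g₀ x₁) ∧
    (∀ x₁ x₂ : ℝ,
      (V x₂ ≠ 0 → Tendsto (fun t : ℝ => g x₁ x₂ t) atTop (nhds c)) ∧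
      (V x₂ = 0 → ∀ t : ℝ, g x₁ x₂ t = g₀ x₁)) ∧
    Tendsto (fun t : ℝ => ⨆ x : ℝ × ℝ, |u₃ x.1 x.2 t|) atTop (nhds 0) := by
  have hu (x₁ x₂ t : ℝ) :
      u₃ x₁ x₂ t = V x₂ * Real.exp (-(lam ^ 2) * V x₂ ^ 2 * t) * deriv g₀ x₁ := by
    have hd : DifferentiableAt ℝ g₀ x₁ := hg₀.differentiable one_ne_zero x₁
    simp_rw [hu₃, hg]
    rw [deriv_const_add, deriv_const_mul _ (hd.sub_const c), deriv_sub_const]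
    ring
  refine ⟨hu, fun x₁ x₂ => ⟨fun hv => ?_, fun hv t => by simp [hg, hv]⟩, ?_⟩
  · have hneg : -(lam ^ 2) * V x₂ ^ 2 < 0 := by
      have := mul_pos (pow_pos hlam 2) (sq_pos_of_ne_zero hv)
      linarith
    have hexp := Real.tendsto_exp_atBot.comp (tendsto_id.const_mul_atTop_of_neg hneg)
    simpa [hg, Function.comp_def] using (hexp.mul_const (g₀ x₁ - c)).const_add c
  · have hper : Function.Periodic (deriv g₀) (2 * π) := periodic_deriv hg₀per
    obtain ⟨M, hM⟩ := (hper.isBounded_of_continuous (by positivity)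
      (hg₀.continuous_deriv le_rfl)).exists_norm_le
    have hM' (x : ℝ) : |deriv g₀ x| ≤ M := hM _ (Set.mem_range_self x)
    have hlim : Tendsto (fun t : ℝ => (lam * √t)⁻¹ * M) atTop (nhds 0) := by
      simpa using ((Real.tendsto_sqrt_atTop.const_mul_atTop hlam).inv_tendsto_atTop).mul_const M
    refine squeeze_zero' (Eventually.of_forall fun t => Real.iSup_nonneg fun _ => abs_nonneg _)
      ?_ hlim
    filter_upwards [eventually_gt_atTop 0] with t ht
    refine ciSup_le fun x => ?_
    rw [hu, abs_mul, abs_mul, Real.abs_exp]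
    exact mul_le_mul (abs_mul_exp_neg_mul_sq_le hlam ht _) (hM' _) (abs_nonneg _) (by positivity)
end

section
/- Let v(x₁,x₂) := (−sin x₁ cos x₂, cos x₁ sin x₂) and let g : ℝ² × ℝ → ℝ be smooth (C^∞) satisfying ∂_t g = (v·∇)(v·∇ g) everywhere. Define B, u : ℝ³ × ℝ → ℝ³ by B(x,t) := (v₁(x₁,x₂), v₂(x₁,x₂), g(x₁,x₂,t)) and u(x,t) := (0, 0, (v·∇g)(x₁,x₂,t)), and define p(x) := (1/4)(cos(2x₁) + cos(2x₂)). Then div B = 0, div u = 0, u = (B·∇)B + ∇p, and ∂_t B + (u·∇)B = (B·∇)u hold everywhere; that is, (B,u,p) is an exact solution of the three-dimensional magnetic relaxation equations with γ = 0. -/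
open Real Filter MeasureTheory

/-- A partial derivative is the derivative of the restriction to a coordinate line. -/
theorem fderiv_apply_single_eq_deriv_update_s13 {n : ℕ} {f : (Fin n → ℝ) → ℝ} {x : Fin n → ℝ}
    (hf : DifferentiableAt ℝ f x) (j : Fin n) :
    fderiv ℝ f x (Pi.single j 1) = deriv (fun z => f (Function.update x j z)) (x j) := by
  have hx : HasFDerivAt f (fderiv ℝ f x) (Function.update x j (x j)) := by
    simpa using hf.hasFDerivAt
  exact (hx.comp_hasDerivAt (x j) (hasDerivAt_update x j (x j))).deriv.symm

theorem differentiable_deriv_fst {g : ℝ → ℝ → ℝ → ℝ}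
    (hg : ContDiff ℝ (⊤ : ℕ∞) (fun q : ℝ × ℝ × ℝ => g q.1 q.2.1 q.2.2)) (t : ℝ) :
    Differentiable ℝ (fun y : ℝ × ℝ => deriv (fun z => g z y.2 t) y.1) := by
  have hd := hg.differentiable (by simp)
  have h (y : ℝ × ℝ) : deriv (fun z => g z y.2 t) y.1 =
      fderiv ℝ (fun q : ℝ × ℝ × ℝ => g q.1 q.2.1 q.2.2) (y.1, y.2, t) (1, 0, 0) := by
    have hc : HasDerivAt (fun z : ℝ => (z, y.2, t)) (1, 0, 0) y.1 :=
      (hasDerivAt_id y.1).prodMk (hasDerivAt_const y.1 (y.2, t))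
    exact ((hd (y.1, y.2, t)).hasFDerivAt.comp_hasDerivAt y.1 hc).deriv
  have hf := (hg.fderiv_right (m := 1) (by norm_cast)).differentiable (by simp)
  simp only [h]
  fun_prop

theorem differentiable_deriv_snd {g : ℝ → ℝ → ℝ → ℝ}
    (hg : ContDiff ℝ (⊤ : ℕ∞) (fun q : ℝ × ℝ × ℝ => g q.1 q.2.1 q.2.2)) (t : ℝ) :
    Differentiable ℝ (fun y : ℝ × ℝ => deriv (fun z => g y.1 z t) y.2) := by
  have hswap : ContDiff ℝ (⊤ : ℕ∞)
      (fun q : ℝ × ℝ × ℝ => (fun a b c => g b a c) q.1 q.2.1 q.2.2) :=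
    hg.comp (g := fun q : ℝ × ℝ × ℝ => g q.1 q.2.1 q.2.2)
      (f := fun q : ℝ × ℝ × ℝ => (q.2.1, q.1, q.2.2)) (by fun_prop)
  exact (differentiable_deriv_fst (g := fun a b c => g b a c) hswap t).comp
    (f := fun y : ℝ × ℝ => (y.2, y.1)) (by fun_prop)

/-- Two-and-a-half dimensional exact solutions of the 3D magnetic relaxation equations
with γ = 0 built from the cellular flow `v = (−sin x₁ cos x₂, cos x₁ sin x₂)`: if
`∂ₜg = (v·∇)(v·∇g)`, then `B = (v₁, v₂, g)`, `u = (0,0, v·∇g)` and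
`p = (1/4)(cos 2x₁ + cos 2x₂)` satisfy `div B = div u = 0`, `u = (B·∇)B + ∇p`, and
`∂ₜB + (u·∇)B = (B·∇)u`. -/
theorem stmt_13 (g : ℝ → ℝ → ℝ → ℝ)
    (hg : ContDiff ℝ (⊤ : ℕ∞) (fun q : ℝ × ℝ × ℝ => g q.1 q.2.1 q.2.2))
    (heq : ∀ x₁ x₂ t : ℝ,
      deriv (fun s => g x₁ x₂ s) t =
        (-Real.sin x₁ * Real.cos x₂) *
          deriv (fun y₁ => (-Real.sin y₁ * Real.cos x₂) * deriv (fun z => g z x₂ t) y₁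
            + (Real.cos y₁ * Real.sin x₂) * deriv (fun z => g y₁ z t) x₂) x₁
        + (Real.cos x₁ * Real.sin x₂) *
          deriv (fun y₂ => (-Real.sin x₁ * Real.cos y₂) * deriv (fun z => g z y₂ t) x₁
            + (Real.cos x₁ * Real.sin y₂) * deriv (fun z => g x₁ z t) y₂) x₂)
    (B u : (Fin 3 → ℝ) → ℝ → Fin 3 → ℝ)
    (hB : ∀ (x : Fin 3 → ℝ) (t : ℝ),
      B x t = ![-Real.sin (x 0) * Real.cos (x 1), Real.cos (x 0) * Real.sin (x 1),
        g (x 0) (x 1) t])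
    (hu : ∀ (x : Fin 3 → ℝ) (t : ℝ),
      u x t = ![0, 0,
        (-Real.sin (x 0) * Real.cos (x 1)) * deriv (fun z => g z (x 1) t) (x 0)
          + (Real.cos (x 0) * Real.sin (x 1)) * deriv (fun z => g (x 0) z t) (x 1)]) :
    (∀ (x : Fin 3 → ℝ) (t : ℝ),
      ∑ j : Fin 3, fderiv ℝ (fun y => B y t j) x (Pi.single j 1) = 0) ∧
    (∀ (x : Fin 3 → ℝ) (t : ℝ),
      ∑ j : Fin 3, fderiv ℝ (fun y => u y t j) x (Pi.single j 1) = 0) ∧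
    (∀ (x : Fin 3 → ℝ) (t : ℝ) (i : Fin 3),
      u x t i = (∑ j : Fin 3, B x t j * fderiv ℝ (fun y => B y t i) x (Pi.single j 1))
        + fderiv ℝ (fun y : Fin 3 → ℝ =>
            (1 / 4) * (Real.cos (2 * y 0) + Real.cos (2 * y 1))) x (Pi.single i 1)) ∧
    (∀ (x : Fin 3 → ℝ) (t : ℝ) (i : Fin 3),
      deriv (fun s => B x s i) t
          + ∑ j : Fin 3, u x t j * fderiv ℝ (fun y => B y t i) x (Pi.single j 1)
        = ∑ j : Fin 3, B x t j * fderiv ℝ (fun y => u y t i) x (Pi.single j 1)) := by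
  have hproj : Differentiable ℝ (fun y : Fin 3 → ℝ => (y 0, y 1)) := by fun_prop
  have hG (t : ℝ) : Differentiable ℝ (fun y : Fin 3 → ℝ => g (y 0) (y 1) t) :=
    (hg.differentiable (by simp)).comp
      (f := fun y : Fin 3 → ℝ => (y 0, y 1, t)) (by fun_prop)
  have hB_diff (t : ℝ) (i : Fin 3) : Differentiable ℝ (fun y => B y t i) := by
    simp only [hB]
    fin_cases i
    · simp; fun_prop
    · simp; fun_prop
    · exact hG t
  have hu_diff (t : ℝ) (i : Fin 3) : Differentiable ℝ (fun y => u y t i) := by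
    have h1 : Differentiable ℝ (fun y : Fin 3 → ℝ => deriv (fun z => g z (y 1) t) (y 0)) :=
      (differentiable_deriv_fst hg t).comp hproj
    have h2 : Differentiable ℝ (fun y : Fin 3 → ℝ => deriv (fun z => g (y 0) z t) (y 1)) :=
      (differentiable_deriv_snd hg t).comp hproj
    simp only [hu]
    fin_cases i <;> (simp; try fun_prop)
  have hp_diff : Differentiable ℝ (fun y : Fin 3 → ℝ =>
      (1 / 4) * (Real.cos (2 * y 0) + Real.cos (2 * y 1))) := by fun_prop
  have hcos (a : ℝ) : deriv (fun z => Real.cos (2 * z)) a = -(2 * Real.sin (2 * a)) := by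
    simp [mul_comm]
  have hBp (t : ℝ) (i : Fin 3) (x : Fin 3 → ℝ) (j : Fin 3) :=
    fderiv_apply_single_eq_deriv_update_s13 (hB_diff t i x) j
  have hup (t : ℝ) (i : Fin 3) (x : Fin 3 → ℝ) (j : Fin 3) :=
    fderiv_apply_single_eq_deriv_update_s13 (hu_diff t i x) j
  have hpp (x : Fin 3 → ℝ) (j : Fin 3) :=
    fderiv_apply_single_eq_deriv_update_s13 (hp_diff x) j
  refine ⟨fun x t => ?_, fun x t => ?_, fun x t i => ?_, fun x t i => ?_⟩
  · simp only [hBp, Fin.sum_univ_three]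
    simp only [hB]
    simp
  · simp only [hup, Fin.sum_univ_three]
    simp only [hu]
    simp
  · simp only [hBp, hpp, Fin.sum_univ_three]
    simp only [hB, hu]
    fin_cases i
    · simp [hcos, Real.sin_two_mul]
      linear_combination (-Real.sin (x 0) * Real.cos (x 0)) * Real.sin_sq_add_cos_sq (x 1)
    · simp [hcos, Real.sin_two_mul]
      linear_combination (-Real.sin (x 1) * Real.cos (x 1)) * Real.sin_sq_add_cos_sq (x 0)
    · simp
  · simp only [hBp, hup, Fin.sum_univ_three]
    simp only [hB, hu]
    fin_cases i
    · simp
    · simp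
    · simpa using heq (x 0) (x 1) t
end

section
/- Let B, u : ℝ³ × ℝ → ℝ³ be smooth (C^∞) satisfying ∂_t B + (u·∇)B = (B·∇)u everywhere. Then at every point, (∂_t + u·∇) |∇B|² ≤ 4 |∇u| |∇B|² + 2 |∇²u| |B| |∇B|, where |∇B| and |∇u| denote the Frobenius norms of the spatial gradient matrices, |∇²u| denotes the Frobenius norm of the array of all second spatial derivatives of u, and |B| is the Euclidean norm. -/
open Real Filter MeasureTheory

section CauchySchwarz

variable {ι κ μ : Type*} [Fintype ι] [Fintype κ] [Fintype μ]

/-- Cauchy–Schwarz for the Frobenius inner product. -/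
theorem sum_sum_mul_le_sqrt_mul_sqrt (b c : ι → κ → ℝ) :
    ∑ i, ∑ j, b i j * c i j
      ≤ √(∑ i, ∑ j, b i j ^ 2) * √(∑ i, ∑ j, c i j ^ 2) := by
  simpa only [Fintype.sum_prod_type] using
    Real.sum_mul_le_sqrt_mul_sqrt Finset.univ (fun p : ι × κ => b p.1 p.2) (fun p => c p.1 p.2)

/-- Submultiplicativity of the Frobenius norm, squared. -/
theorem sum_sum_sum_mul_sq_le (a : ι → μ → ℝ) (b : μ → κ → ℝ) :
    ∑ i, ∑ j, (∑ m, a i m * b m j) ^ 2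
      ≤ (∑ i, ∑ m, a i m ^ 2) * ∑ m, ∑ j, b m j ^ 2 := by
  rw [Finset.sum_comm (f := fun m j => b m j ^ 2), Finset.sum_mul_sum]
  gcongr
  exact Finset.sum_mul_sq_le_sq_mul_sq _ _ _

/-- Contracting a matrix with a product of matrices, in Frobenius norms. -/
theorem abs_sum_sum_mul_sum_le (c : ι → κ → ℝ) (a : ι → μ → ℝ) (b : μ → κ → ℝ) :
    |∑ i, ∑ j, c i j * ∑ m, a i m * b m j|
      ≤ √(∑ i, ∑ j, c i j ^ 2)
        * (√(∑ i, ∑ m, a i m ^ 2) * √(∑ m, ∑ j, b m j ^ 2)) := by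
  have key : √(∑ i, ∑ j, (∑ m, a i m * b m j) ^ 2)
      ≤ √(∑ i, ∑ m, a i m ^ 2) * √(∑ m, ∑ j, b m j ^ 2) := by
    rw [← Real.sqrt_mul (by positivity)]
    exact Real.sqrt_le_sqrt (sum_sum_sum_mul_sq_le a b)
  refine le_trans ?_ (mul_le_mul_of_nonneg_left key (Real.sqrt_nonneg _))
  refine abs_le'.2 ⟨sum_sum_mul_le_sqrt_mul_sqrt _ _, ?_⟩
  simpa using sum_sum_mul_le_sqrt_mul_sqrt (fun i j => -c i j) (fun i j => ∑ m, a i m * b m j)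

/-- Contracting a matrix with a three-index array and a vector, in Frobenius norms. -/
theorem sum_sum_mul_sum_le (c : ι → κ → ℝ) (v : μ → ℝ) (h : ι → κ → μ → ℝ) :
    ∑ i, ∑ j, c i j * ∑ m, v m * h i j m
      ≤ √(∑ i, ∑ j, c i j ^ 2)
        * (√(∑ m, v m ^ 2) * √(∑ i, ∑ j, ∑ m, h i j m ^ 2)) := by
  refine (sum_sum_mul_le_sqrt_mul_sqrt _ _).trans ?_
  gcongr
  rw [← Real.sqrt_mul (by positivity)]
  refine Real.sqrt_le_sqrt ?_
  simp_rw [Finset.mul_sum (s := Finset.univ) (f := fun i => ∑ j, ∑ m, h i j m ^ 2),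
    Finset.mul_sum (s := Finset.univ) (f := fun j => ∑ m, h _ j m ^ 2)]
  gcongr
  exact Finset.sum_mul_sq_le_sq_mul_sq _ _ _

end CauchySchwarz

section Derivatives

variable {E : Type*} [NormedAddCommGroup E] [NormedSpace ℝ E]

theorem fderiv_comp_prodMk_right {f : E × ℝ → ℝ} {x : E} {t : ℝ}
    (hf : DifferentiableAt ℝ f (x, t)) (v : E) :
    fderiv ℝ (fun y => f (y, t)) x v = fderiv ℝ f (x, t) (v, 0) := by
  have h := hf.hasFDerivAt.comp x (hasFDerivAt_prodMk_left (𝕜 := ℝ) x t)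
  rw [show (fun y => f (y, t)) = f ∘ fun y => (y, t) from rfl, h.fderiv]
  simp

theorem deriv_comp_prodMk_left {f : E × ℝ → ℝ} {x : E} {t : ℝ}
    (hf : DifferentiableAt ℝ f (x, t)) :
    deriv (fun s => f (x, s)) t = fderiv ℝ f (x, t) (0, 1) := by
  have h := hf.hasFDerivAt.comp t (hasFDerivAt_prodMk_right (𝕜 := ℝ) x t)
  rw [show (fun s => f (x, s)) = f ∘ fun s => (x, s) from rfl, h.hasDerivAt.deriv]
  simp

theorem ContDiff.differentiable_fderiv_apply {f : E → ℝ} (hf : ContDiff ℝ (⊤ : ℕ∞) f) (v : E) :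
    Differentiable ℝ fun q => fderiv ℝ f q v :=
  ((hf.fderiv_right (m := 1) (by norm_cast)).clm_apply contDiff_const).differentiable (by simp)

theorem ContDiff.fderiv_fderiv_apply_comm {f : E → ℝ} (hf : ContDiff ℝ (⊤ : ℕ∞) f) (q v w : E) :
    fderiv ℝ (fun p => fderiv ℝ f p v) q w = fderiv ℝ (fun p => fderiv ℝ f p w) q v := by
  have hd : DifferentiableAt ℝ (fderiv ℝ f) q :=
    (hf.fderiv_right (m := 1) (by norm_cast)).differentiable (by simp) q
  have hs : IsSymmSndFDerivAt ℝ f q :=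
    (hf.of_le (m := ((2 : ℕ∞) : WithTop ℕ∞)) (WithTop.coe_le_coe.2 le_top)).contDiffAt.isSymmSndFDerivAt (by simp)
  simpa [fderiv_clm_apply hd (differentiableAt_const _)] using hs w v

theorem fderiv_sum_sum_sq {ι κ : Type*} [Fintype ι] [Fintype κ] {b : ι → κ → E → ℝ} {q : E}
    (hb : ∀ i j, DifferentiableAt ℝ (b i j) q) (w : E) :
    fderiv ℝ (fun p => ∑ i, ∑ j, b i j p ^ 2) q w
      = ∑ i, ∑ j, 2 * (b i j q * fderiv ℝ (b i j) q w) := by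
  have h : HasFDerivAt (fun p => ∑ i, ∑ j, b i j p ^ 2)
      (∑ i, ∑ j, (2 * b i j q) • fderiv ℝ (b i j) q) q := by
    refine HasFDerivAt.fun_sum fun i _ => HasFDerivAt.fun_sum fun j _ => ?_
    simpa using (hb i j).hasFDerivAt.pow 2
  simp [h.fderiv, mul_assoc]

theorem fderiv_sum_mul {ι : Type*} [Fintype ι] {a b : ι → E → ℝ} {q : E}
    (ha : ∀ i, DifferentiableAt ℝ (a i) q) (hb : ∀ i, DifferentiableAt ℝ (b i) q) (w : E) :
    fderiv ℝ (fun p => ∑ i, a i p * b i p) q w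
      = ∑ i, (a i q * fderiv ℝ (b i) q w + b i q * fderiv ℝ (a i) q w) := by
  have h := HasFDerivAt.fun_sum (u := Finset.univ) fun i _ =>
    (ha i).hasFDerivAt.fun_mul (hb i).hasFDerivAt
  simp [h.fderiv]

/-- The derivative along `e k` of the frozen-field equation `D_τ F + U·D F = F·D U`. -/
theorem fderiv_frozen_field {ι : Type*} [Fintype ι] {F U : ι → E → ℝ} {τ : E} {e : ι → E}
    (hF : ∀ i, ContDiff ℝ (⊤ : ℕ∞) (F i)) (hU : ∀ i, ContDiff ℝ (⊤ : ℕ∞) (U i))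
    (h : ∀ q i, fderiv ℝ (F i) q τ + ∑ m, U m q * fderiv ℝ (F i) q (e m)
      = ∑ m, F m q * fderiv ℝ (U i) q (e m)) (q : E) (i k : ι) :
    fderiv ℝ (fun p => fderiv ℝ (F i) p (e k)) q τ
        + ∑ m, U m q * fderiv ℝ (fun p => fderiv ℝ (F i) p (e k)) q (e m)
      = ∑ m, fderiv ℝ (U i) q (e m) * fderiv ℝ (F m) q (e k)
        + ∑ m, F m q * fderiv ℝ (fun p => fderiv ℝ (U i) p (e m)) q (e k)
        - ∑ m, fderiv ℝ (F i) q (e m) * fderiv ℝ (U m) q (e k) := by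
  have dF i : DifferentiableAt ℝ (F i) q := (hF i).differentiable (by simp) q
  have dU i : DifferentiableAt ℝ (U i) q := (hU i).differentiable (by simp) q
  have ddF i v := (hF i).differentiable_fderiv_apply v q
  have ddU i v := (hU i).differentiable_fderiv_apply v q
  have h' := congrArg (fun g : E → ℝ => fderiv ℝ g q (e k)) (funext fun p => h p i)
  rw [fderiv_fun_add (ddF i τ)
      (DifferentiableAt.fun_sum fun m _ => (dU m).fun_mul (ddF i (e m))),
    add_apply, fderiv_sum_mul dU fun m => ddF i (e m),
    fderiv_sum_mul dF fun m => ddU i (e m), Finset.sum_add_distrib, Finset.sum_add_distrib,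
    (hF i).fderiv_fderiv_apply_comm q τ (e k)] at h'
  simp_rw [(hF i).fderiv_fderiv_apply_comm q _ (e k)] at h'
  linarith

/-- The material derivative of the squared gradient of a frozen-in field is controlled by the
first and second derivatives of the velocity. -/
theorem fderiv_sum_sq_frozen_field_le {ι : Type*} [Fintype ι] {F U : ι → E → ℝ} {τ : E}
    {e : ι → E} (hF : ∀ i, ContDiff ℝ (⊤ : ℕ∞) (F i)) (hU : ∀ i, ContDiff ℝ (⊤ : ℕ∞) (U i))
    (h : ∀ q i, fderiv ℝ (F i) q τ + ∑ m, U m q * fderiv ℝ (F i) q (e m)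
      = ∑ m, F m q * fderiv ℝ (U i) q (e m)) (q : E) :
    fderiv ℝ (fun p => ∑ i, ∑ j, fderiv ℝ (F i) p (e j) ^ 2) q τ
        + ∑ m, U m q * fderiv ℝ (fun p => ∑ i, ∑ j, fderiv ℝ (F i) p (e j) ^ 2) q (e m)
      ≤ 4 * √(∑ i, ∑ j, fderiv ℝ (U i) q (e j) ^ 2) * (∑ i, ∑ j, fderiv ℝ (F i) q (e j) ^ 2)
        + 2 * √(∑ i, ∑ j, ∑ k, fderiv ℝ (fun p => fderiv ℝ (U i) p (e k)) q (e j) ^ 2)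
          * √(∑ i, F i q ^ 2) * √(∑ i, ∑ j, fderiv ℝ (F i) q (e j) ^ 2) := by
  have hsq (w : E) := fderiv_sum_sum_sq (q := q)
    (b := fun i j p => fderiv ℝ (F i) p (e j))
    (fun i j => (hF i).differentiable_fderiv_apply (e j) q) w
  set b : ι → ι → ℝ := fun i j => fderiv ℝ (F i) q (e j)
  set g : ι → ι → ℝ := fun i j => fderiv ℝ (U i) q (e j)
  set H : ι → ι → ι → ℝ := fun i j k => fderiv ℝ (fun p => fderiv ℝ (U i) p (e k)) q (e j)
  have hL : fderiv ℝ (fun p => ∑ i, ∑ j, fderiv ℝ (F i) p (e j) ^ 2) q τ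
        + ∑ m, U m q * fderiv ℝ (fun p => ∑ i, ∑ j, fderiv ℝ (F i) p (e j) ^ 2) q (e m)
      = 2 * (∑ i, ∑ j, b i j * ∑ m, g i m * b m j)
        + 2 * (∑ i, ∑ j, b i j * ∑ m, F m q * H i j m)
        - 2 * (∑ i, ∑ j, b i j * ∑ m, b i m * g m j) := by
    have hswap : ∑ m, U m q * ∑ i, ∑ j,
          2 * (b i j * fderiv ℝ (fun p => fderiv ℝ (F i) p (e j)) q (e m))
        = ∑ i, ∑ j, 2 * (b i j *
            ∑ m, U m q * fderiv ℝ (fun p => fderiv ℝ (F i) p (e j)) q (e m)) := by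
      simp_rw [Finset.mul_sum]
      rw [Finset.sum_comm]
      refine Finset.sum_congr rfl fun i _ => ?_
      rw [Finset.sum_comm]
      refine Finset.sum_congr rfl fun j _ => Finset.sum_congr rfl fun m _ => ?_
      ring
    simp_rw [hsq]
    rw [hswap]
    simp_rw [Finset.mul_sum (a := (2 : ℝ)), ← Finset.sum_add_distrib, ← Finset.sum_sub_distrib]
    refine Finset.sum_congr rfl fun i _ => Finset.sum_congr rfl fun j _ => ?_
    linear_combination (2 * b i j) * fderiv_frozen_field hF hU h q i j
  have h1 := (abs_le.1 (abs_sum_sum_mul_sum_le b g b)).2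
  have h2 := sum_sum_mul_sum_le b (fun m => F m q) H
  have h3 := (abs_le.1 (abs_sum_sum_mul_sum_le b b g)).1
  have hN : √(∑ i, ∑ j, b i j ^ 2) * √(∑ i, ∑ j, b i j ^ 2) = ∑ i, ∑ j, b i j ^ 2 :=
    Real.mul_self_sqrt (by positivity)
  rw [hL]
  change _ ≤ 4 * √(∑ i, ∑ j, g i j ^ 2) * (∑ i, ∑ j, b i j ^ 2)
    + 2 * √(∑ i, ∑ j, ∑ k, H i j k ^ 2) * √(∑ i, F i q ^ 2) * √(∑ i, ∑ j, b i j ^ 2)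
  linear_combination 2 * h1 + 2 * h2 + 2 * h3 + 4 * √(∑ i, ∑ j, g i j ^ 2) * hN

end Derivatives

/-- Pointwise inequality for the gradient of solutions of the frozen-field equation
`∂ₜB + (u·∇)B = (B·∇)u`:
`(∂ₜ + u·∇)|∇B|² ≤ 4|∇u||∇B|² + 2|∇²u||B||∇B|`, with Frobenius norms of the gradient
matrices and the array of second derivatives of `u`. -/
theorem stmt_16 (B u : (Fin 3 → ℝ) → ℝ → Fin 3 → ℝ)
    (hB : ContDiff ℝ (⊤ : ℕ∞) (fun q : (Fin 3 → ℝ) × ℝ => B q.1 q.2))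
    (hu : ContDiff ℝ (⊤ : ℕ∞) (fun q : (Fin 3 → ℝ) × ℝ => u q.1 q.2))
    (hevol : ∀ (x : Fin 3 → ℝ) (t : ℝ) (i : Fin 3),
      deriv (fun s => B x s i) t
          + ∑ j : Fin 3, u x t j * fderiv ℝ (fun y => B y t i) x (Pi.single j 1)
        = ∑ j : Fin 3, B x t j * fderiv ℝ (fun y => u y t i) x (Pi.single j 1)) :
    ∀ (x : Fin 3 → ℝ) (t : ℝ),
      deriv (fun s => ∑ i : Fin 3, ∑ j : Fin 3,
          (fderiv ℝ (fun y => B y s i) x (Pi.single j 1)) ^ 2) t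
        + ∑ m : Fin 3, u x t m *
            fderiv ℝ (fun y => ∑ i : Fin 3, ∑ j : Fin 3,
              (fderiv ℝ (fun z => B z t i) y (Pi.single j 1)) ^ 2) x (Pi.single m 1)
      ≤ 4 * Real.sqrt (∑ i : Fin 3, ∑ j : Fin 3,
            (fderiv ℝ (fun y => u y t i) x (Pi.single j 1)) ^ 2)
          * (∑ i : Fin 3, ∑ j : Fin 3,
            (fderiv ℝ (fun y => B y t i) x (Pi.single j 1)) ^ 2)
        + 2 * Real.sqrt (∑ i : Fin 3, ∑ j : Fin 3, ∑ k : Fin 3,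
            (fderiv ℝ (fun y =>
              fderiv ℝ (fun z => u z t i) y (Pi.single k 1)) x (Pi.single j 1)) ^ 2)
          * Real.sqrt (∑ i : Fin 3, (B x t i) ^ 2)
          * Real.sqrt (∑ i : Fin 3, ∑ j : Fin 3,
            (fderiv ℝ (fun y => B y t i) x (Pi.single j 1)) ^ 2) := by
  intro x t
  have hF i : ContDiff ℝ (⊤ : ℕ∞) fun q : (Fin 3 → ℝ) × ℝ => B q.1 q.2 i := contDiff_pi.1 hB i
  have hU i : ContDiff ℝ (⊤ : ℕ∞) fun q : (Fin 3 → ℝ) × ℝ => u q.1 q.2 i := contDiff_pi.1 hu i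
  have sF i (y : Fin 3 → ℝ) (s : ℝ) (v : Fin 3 → ℝ) :=
    fderiv_comp_prodMk_right ((hF i).differentiable (by simp) (y, s)) v
  have sU i (y : Fin 3 → ℝ) (s : ℝ) (v : Fin 3 → ℝ) :=
    fderiv_comp_prodMk_right ((hU i).differentiable (by simp) (y, s)) v
  have tF i (y : Fin 3 → ℝ) (s : ℝ) :=
    deriv_comp_prodMk_left ((hF i).differentiable (by simp) (y, s))
  have ssU i (v w : Fin 3 → ℝ) := fderiv_comp_prodMk_right (x := x) (t := t)
    ((hU i).differentiable_fderiv_apply (v, 0) (x, t)) w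
  have hN : DifferentiableAt ℝ (fun p : (Fin 3 → ℝ) × ℝ => ∑ i : Fin 3, ∑ j : Fin 3,
      fderiv ℝ (fun q : (Fin 3 → ℝ) × ℝ => B q.1 q.2 i) p (Pi.single j 1, 0) ^ 2) (x, t) :=
    DifferentiableAt.fun_sum fun i _ => DifferentiableAt.fun_sum fun j _ =>
      ((hF i).differentiable_fderiv_apply _ _).fun_pow 2
  have sN (v : Fin 3 → ℝ) := fderiv_comp_prodMk_right hN v
  have tN := deriv_comp_prodMk_left hN
  simp only at sF sU tF
  simp_rw [sF, sU, tF] at hevol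
  simp_rw [sF, sU, ssU, sN, tN]
  exact fderiv_sum_sq_frozen_field_le (τ := ((0 : Fin 3 → ℝ), (1 : ℝ)))
    (e := fun j => (Pi.single j 1, 0)) hF hU (fun q i => hevol q.1 q.2 i) (x, t)
end

section
/- Let V : ℝ → ℝ be continuously differentiable and g₀ : ℝ² → ℝ continuously differentiable. Define u : ℝ³ × ℝ → ℝ³ by u(x,t) := ( V(x₂), 0, g₀(x₁ − t V(x₂), x₂) ). Then div u = 0 and ∂_t u + (u·∇)u = 0 everywhere; that is, u is an exact solution of the three-dimensional incompressible Euler equations with constant pressure. -/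
open Real Filter MeasureTheory

/-- Yudovich's two-and-a-half dimensional exact solution of the 3D incompressible Euler
equations with constant pressure: `u(x,t) = (V(x₂), 0, g₀(x₁ − tV(x₂), x₂))` satisfies
`div u = 0` and `∂ₜu + (u·∇)u = 0`. -/
theorem stmt_17 (V : ℝ → ℝ) (g₀ : ℝ → ℝ → ℝ)
    (hV : ContDiff ℝ 1 V)
    (hg₀ : ContDiff ℝ 1 (fun q : ℝ × ℝ => g₀ q.1 q.2))
    (u : (Fin 3 → ℝ) → ℝ → Fin 3 → ℝ)
    (hu : ∀ (x : Fin 3 → ℝ) (t : ℝ),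
      u x t = ![V (x 1), 0, g₀ (x 0 - t * V (x 1)) (x 1)]) :
    (∀ (x : Fin 3 → ℝ) (t : ℝ),
      ∑ j : Fin 3, fderiv ℝ (fun y => u y t j) x (Pi.single j 1) = 0) ∧
    (∀ (x : Fin 3 → ℝ) (t : ℝ) (i : Fin 3),
      deriv (fun s => u x s i) t
        + ∑ j : Fin 3, u x t j * fderiv ℝ (fun y => u y t i) x (Pi.single j 1) = 0) := by
  have hV' (z : ℝ) : HasDerivAt V (deriv V z) z :=
    (hV.differentiable one_ne_zero z).hasDerivAt
  have hshear (x : Fin 3 → ℝ) : HasFDerivAt (fun y : Fin 3 → ℝ => V (y 1))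
      (deriv V (x 1) • ContinuousLinearMap.proj (R := ℝ) (φ := fun _ : Fin 3 => ℝ) 1) x :=
    (hV' (x 1)).comp_hasFDerivAt x (hasFDerivAt_apply (𝕜 := ℝ) (1 : Fin 3) x)
  have hG (q : ℝ × ℝ) := (hg₀.differentiable one_ne_zero q).hasFDerivAt
  have hspace (x : Fin 3 → ℝ) (t : ℝ) :=
    HasFDerivAt.comp (f := fun y : Fin 3 → ℝ => (y 0 - t * V (y 1), y 1)) x
      (hG (x 0 - t * V (x 1), x 1))
      (((hasFDerivAt_apply (𝕜 := ℝ) (0 : Fin 3) x).sub ((hshear x).const_mul t)).prodMk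
        (hasFDerivAt_apply (𝕜 := ℝ) (1 : Fin 3) x))
  have htime (x : Fin 3 → ℝ) (t : ℝ) :=
    HasFDerivAt.comp_hasDerivAt (f := fun s : ℝ => (x 0 - s * V (x 1), x 1)) t
      (hG (x 0 - t * V (x 1), x 1))
      ((((hasDerivAt_id t).mul_const (V (x 1))).const_sub (x 0)).prodMk
        (hasDerivAt_const t (x 1)))
  simp only [Function.comp_def] at hspace htime
  have hzero (L : ℝ × ℝ →L[ℝ] ℝ) : L (0, 0) = 0 := map_zero L
  refine ⟨fun x t => ?_, fun x t i => ?_⟩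
  · simp [Fin.sum_univ_three, hu, (hshear x).fderiv, (hspace x t).fderiv, hzero]
  · fin_cases i
    · simp [Fin.sum_univ_three, hu, (hshear x).fderiv]
    · simp [hu]
    · have hscale (L : ℝ × ℝ →L[ℝ] ℝ) (c : ℝ) : L (-c, 0) = -(c * L (1, 0)) := by
        rw [← smul_eq_mul, ← map_smul, ← map_neg]
        simp
      simp [Fin.sum_univ_three, hu, (hspace x t).fderiv, (htime x t).deriv, hscale, hzero]
end

section
/- Let v(x₁,x₂) := (−sin x₁ cos x₂, cos x₁ sin x₂) and let g : ℝ² × [0,∞) → ℝ be smooth (C^∞) satisfying the transport equation ∂_t g + v·∇g = 0 everywhere. Then for all t ≥ 0, ∂₁g(0,0,t) = e^t ∂₁g(0,0,0). -/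
open Real Filter MeasureTheory

/-- The derivative of a directional derivative along an affine line. -/
theorem hasDerivAt_fderiv_apply_line {E : Type*} [NormedAddCommGroup E] [NormedSpace ℝ E]
    {f : E → ℝ} (hf : ContDiff ℝ 2 f) {c : ℝ → E} {u : E} {s : ℝ} (hc : HasDerivAt c u s) (v : E) :
    HasDerivAt (fun r => fderiv ℝ f (c r) v) (fderiv ℝ (fderiv ℝ f) (c s) u v) s := by
  have hd : Differentiable ℝ (fderiv ℝ f) :=
    (hf.fderiv_right (m := 1) (by norm_num)).differentiable (by norm_num)
  have h := (hd (c s)).hasFDerivAt.comp_hasDerivAt s hc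
  simpa using h.clm_apply (hasDerivAt_const s v)

/-- If `∂ₜf = sin x ∂ₓf` for `t ≥ 0`, then `∂ₓf(0,t) = eᵗ ∂ₓf(0,0)` for `t ≥ 0`. -/
theorem fderiv_zero_eq_exp_mul_of_sin_transport {f : ℝ × ℝ → ℝ} (hf : ContDiff ℝ 2 f)
    (heq : ∀ x t : ℝ, 0 ≤ t →
      fderiv ℝ f (x, t) (0, 1) = Real.sin x * fderiv ℝ f (x, t) (1, 0))
    {t : ℝ} (ht : 0 ≤ t) :
    fderiv ℝ f (0, t) (1, 0) = Real.exp t * fderiv ℝ f (0, 0) (1, 0) := by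
  have hline₁ (x t : ℝ) : HasDerivAt (fun y : ℝ => (y, t)) ((1 : ℝ), (0 : ℝ)) x :=
    (hasDerivAt_id x).prodMk (hasDerivAt_const x t)
  have hline₂ (x t : ℝ) : HasDerivAt (fun s : ℝ => (x, s)) ((0 : ℝ), (1 : ℝ)) t :=
    (hasDerivAt_const t x).prodMk (hasDerivAt_id t)
  have hgrowth (s : ℝ) (hs : 0 ≤ s) :
      HasDerivAt (fun r => fderiv ℝ f (0, r) (1, 0)) (fderiv ℝ f (0, s) (1, 0)) s := by
    have hmixed := hasDerivAt_fderiv_apply_line hf (hline₁ 0 s) (0, 1)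
    have hsin := (Real.hasDerivAt_sin 0).mul
      (hasDerivAt_fderiv_apply_line hf (hline₁ 0 s) (1, 0))
    have hfun : (fun y : ℝ => fderiv ℝ f (y, s) (0, 1))
        = Real.sin * fun y : ℝ => fderiv ℝ f (y, s) (1, 0) :=
      funext fun y => heq y s hs
    rw [hfun] at hmixed
    have hval := hmixed.unique hsin
    simp only [Real.cos_zero, Real.sin_zero, one_mul, zero_mul, add_zero] at hval
    have hsymm : IsSymmSndFDerivAt ℝ f (0, s) :=
      hf.contDiffAt.isSymmSndFDerivAt (by simp)
    rw [← hval, hsymm.eq]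
    exact hasDerivAt_fderiv_apply_line hf (hline₂ 0 s) (1, 0)
  have hconst (s : ℝ) (hs : 0 ≤ s) :
      HasDerivAt (fun r => Real.exp (-r) * fderiv ℝ f (0, r) (1, 0)) 0 s := by
    exact ((hasDerivAt_neg s).exp.mul (hgrowth s hs)).congr_deriv (by ring)
  have h := constant_of_has_deriv_right_zero (a := 0) (b := t)
    (fun s hs => (hconst s hs.1).continuousAt.continuousWithinAt)
    (fun s hs => (hconst s hs.1).hasDerivWithinAt) t ⟨ht, le_rfl⟩
  simp only [neg_zero, Real.exp_zero, one_mul] at h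
  rw [← h, ← mul_assoc, ← Real.exp_add, add_neg_cancel, Real.exp_zero, one_mul]

/-- Exponential growth of `∂₁g` at the hyperbolic stagnation point of the cellular flow
`v = (−sin x₁ cos x₂, cos x₁ sin x₂)`: if `g` is smooth and solves the transport
equation `∂ₜg + v·∇g = 0`, then `∂₁g(0,0,t) = eᵗ ∂₁g(0,0,0)` for all `t ≥ 0`. -/
theorem stmt_19 (g : ℝ → ℝ → ℝ → ℝ)
    (hg : ContDiff ℝ (⊤ : ℕ∞) (fun q : ℝ × ℝ × ℝ => g q.1 q.2.1 q.2.2))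
    (heq : ∀ x₁ x₂ t : ℝ, 0 ≤ t →
      deriv (fun s => g x₁ x₂ s) t
        + ((-Real.sin x₁ * Real.cos x₂) * deriv (fun y => g y x₂ t) x₁
          + (Real.cos x₁ * Real.sin x₂) * deriv (fun y => g x₁ y t) x₂) = 0) :
    ∀ t : ℝ, 0 ≤ t →
      deriv (fun y => g y 0 t) 0 = Real.exp t * deriv (fun y => g y 0 0) 0 := by
  have hf : ContDiff ℝ 2 (fun p : ℝ × ℝ => g p.1 0 p.2) := by
    have hle : (2 : WithTop ℕ∞) ≤ ((⊤ : ℕ∞) : WithTop ℕ∞) := WithTop.coe_le_coe.2 le_top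
    exact (hg.of_le hle).comp
      (contDiff_fst.prodMk (contDiff_const.prodMk contDiff_snd) :
        ContDiff ℝ 2 (fun p : ℝ × ℝ => (p.1, (0 : ℝ), p.2)))
  have hd := hf.differentiable (by norm_num)
  have hx (x t : ℝ) : deriv (fun y => g y 0 t) x
      = fderiv ℝ (fun p : ℝ × ℝ => g p.1 0 p.2) (x, t) (1, 0) :=
    (HasFDerivAt.comp_hasDerivAt (f := fun y : ℝ => (y, t)) x (hd (x, t)).hasFDerivAt
      ((hasDerivAt_id x).prodMk (hasDerivAt_const x t))).deriv
  have ht (x t : ℝ) : deriv (fun s => g x 0 s) t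
      = fderiv ℝ (fun p : ℝ × ℝ => g p.1 0 p.2) (x, t) (0, 1) :=
    (HasFDerivAt.comp_hasDerivAt (f := fun s : ℝ => (x, s)) t (hd (x, t)).hasFDerivAt
      ((hasDerivAt_const t x).prodMk (hasDerivAt_id t))).deriv
  intro t ht₀
  rw [hx, hx]
  refine fderiv_zero_eq_exp_mul_of_sin_transport hf (fun x s hs => ?_) ht₀
  have h := heq x 0 s hs
  rw [Real.sin_zero, Real.cos_zero, hx, ht] at h
  linarith
end
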